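/- Let G be a candidate and let C be a clean shortest long even hole in G. Let u, v be distinct nonadjacent vertices of V(C) with d_C(u,v) ≤ |E(C)|/2 − 2, and let L1, L2 be the two uv-paths of C, where |E(L1)| ≤ |E(C)|/2 − 2. Then for every shortest uv-path P in G, the subgraph P ∪ L2 is a shortest long even hole in G. -/

import Mathlib

open SimpleGraph

namespace LEH

open scoped Classical

variable {V : Type*}

/-- `X` is anticomplete to `Y`: they are disjoint and there are no edges between them. -/
def Anticomplete (G : SimpleGraph V) (X Y : Set V) : Prop :=
  ∀ ⦃x⦄, x ∈ X → ∀ ⦃y⦄, y ∈ Y → x ≠ y ∧ ¬ G.Adj x y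

/-- The vertex set of a walk. -/
def vset {G : SimpleGraph V} {u v : V} (P : G.Walk u v) : Set V :=
  {x | x ∈ P.support}

/-- The interior of a path: its non-end vertices. -/
def inter {G : SimpleGraph V} {u v : V} (P : G.Walk u v) : Set V :=
  {x | x ∈ P.support ∧ x ≠ u ∧ x ≠ v}

/-- An induced path in `G`. -/
def IsInducedPath {G : SimpleGraph V} {u v : V} (P : G.Walk u v) : Prop :=
  P.IsPath ∧ ∀ x ∈ P.support, ∀ y ∈ P.support, G.Adj x y → s(x, y) ∈ P.edges

/-- A hole: an induced cycle of length at least 4. -/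
def IsHole {G : SimpleGraph V} {u : V} (c : G.Walk u u) : Prop :=
  c.IsCycle ∧ 4 ≤ c.length ∧
    ∀ x ∈ c.support, ∀ y ∈ c.support, G.Adj x y → s(x, y) ∈ c.edges

/-- A long even hole: a hole of even length at least `ℓ`. -/
def IsLongEvenHole (ℓ : ℕ) {G : SimpleGraph V} {u : V} (c : G.Walk u u) : Prop :=
  IsHole c ∧ ℓ ≤ c.length ∧ Even c.length

def HasLongEvenHole (G : SimpleGraph V) (ℓ : ℕ) : Prop :=
  ∃ (u : V) (c : G.Walk u u), IsLongEvenHole ℓ c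

/-- A long theta in `G`: two nonadjacent vertices joined by three internally disjoint
induced paths with no edges between their interiors, any two of which form a long hole. -/
def HasLongTheta (G : SimpleGraph V) (ℓ : ℕ) : Prop :=
  ∃ (u v : V) (P₁ P₂ P₃ : G.Walk u v),
    u ≠ v ∧ ¬ G.Adj u v ∧
    IsInducedPath P₁ ∧ IsInducedPath P₂ ∧ IsInducedPath P₃ ∧
    Anticomplete G (inter P₁) (inter P₂) ∧
    Anticomplete G (inter P₁) (inter P₃) ∧
    Anticomplete G (inter P₂) (inter P₃) ∧
    ℓ ≤ P₁.length + P₂.length ∧ ℓ ≤ P₁.length + P₃.length ∧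
    ℓ ≤ P₂.length + P₃.length

/-- A long jewel of order `k` formed by `Q₁, Q₂, P`. -/
def IsLongJewel (ℓ k : ℕ) {G : SimpleGraph V} {u v : V}
    (Q₁ Q₂ P : G.Walk u v) : Prop :=
  u ≠ v ∧
  IsInducedPath Q₁ ∧ IsInducedPath Q₂ ∧ IsInducedPath P ∧
  ¬ (Even Q₁.length ↔ Even Q₂.length) ∧
  max Q₁.support.length Q₂.support.length = k ∧
  ℓ ≤ P.length + min Q₁.length Q₂.length ∧
  Anticomplete G (inter P) (inter Q₁ ∪ inter Q₂)

def HasLongJewel (G : SimpleGraph V) (ℓ k : ℕ) : Prop :=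
  ∃ (u v : V) (Q₁ Q₂ P : G.Walk u v), IsLongJewel ℓ k Q₁ Q₂ P

/-- A long ban-the-bomb in `G`. -/
def IsLongBanTheBomb (ℓ : ℕ) {G : SimpleGraph V} (u v₁ w v₂ x : V)
    (P₁ : G.Walk x v₁) (P₂ : G.Walk x v₂) : Prop :=
  G.Adj u v₁ ∧ G.Adj v₁ w ∧ G.Adj w v₂ ∧ G.Adj v₂ u ∧ ¬ G.Adj v₁ v₂ ∧ u ≠ w ∧
  G.Adj x u ∧ ¬ G.Adj x v₁ ∧ ¬ G.Adj x v₂ ∧ ¬ G.Adj x w ∧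
  x ≠ v₁ ∧ x ≠ v₂ ∧ x ≠ w ∧
  IsInducedPath P₁ ∧ IsInducedPath P₂ ∧
  2 ≤ P₁.length ∧ 2 ≤ P₂.length ∧
  Anticomplete G (inter P₁) {u, w} ∧ Anticomplete G (inter P₂) {u, w} ∧
  Anticomplete G (vset P₁ \ {x}) (vset P₂ \ {x}) ∧
  ℓ ≤ P₁.length + 2 ∧ ℓ ≤ P₂.length + 2 ∧ ℓ ≤ P₁.length + P₂.length + 2

def HasLongBanTheBomb (G : SimpleGraph V) (ℓ : ℕ) : Prop :=
  ∃ (u v₁ w v₂ x : V) (P₁ : G.Walk x v₁) (P₂ : G.Walk x v₂),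
    IsLongBanTheBomb ℓ u v₁ w v₂ x P₁ P₂

/-- The induced subgraph of `G` on the vertex set `S` is a long hole. -/
def IsLongHoleOn (G : SimpleGraph V) (ℓ : ℕ) (S : Set V) : Prop :=
  ∃ (u : V) (c : G.Walk u u), IsHole c ∧ ℓ ≤ c.length ∧ {x | x ∈ c.support} = S

/-- A long near-prism with triangles `{a 0, a 1, a 2}`, `{b 0, b 1, b 2}` and
constituent paths `P 0, P 1, P 2`. -/
def IsLongNearPrism (ℓ : ℕ) {G : SimpleGraph V} (a b : Fin 3 → V)
    (P : ∀ i : Fin 3, G.Walk (a i) (b i)) : Prop :=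
  (∀ i j, i ≠ j → G.Adj (a i) (a j)) ∧
  (∀ i j, i ≠ j → G.Adj (b i) (b j)) ∧
  (Set.range a ∩ Set.range b).Subsingleton ∧
  (∀ i, (P i).IsPath) ∧
  (∀ i j, i ≠ j → ∀ x, x ∈ (P i).support → x ∉ (P j).support) ∧
  (∀ i j, i ≠ j → IsLongHoleOn G ℓ (vset (P i) ∪ vset (P j)))

def HasLongNearPrism (G : SimpleGraph V) (ℓ : ℕ) : Prop :=
  ∃ (a b : Fin 3 → V) (P : ∀ i : Fin 3, G.Walk (a i) (b i)), IsLongNearPrism ℓ a b P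

/-- A prospect: no long even hole of length at most `2ℓ`, no long jewel of order at most
`ℓ+1`, no long theta and no long ban-the-bomb. -/
def Prospect (G : SimpleGraph V) (ℓ : ℕ) : Prop :=
  (¬ ∃ (u : V) (c : G.Walk u u), IsLongEvenHole ℓ c ∧ c.length ≤ 2 * ℓ) ∧
  (¬ ∃ k ≤ ℓ + 1, HasLongJewel G ℓ k) ∧
  ¬ HasLongTheta G ℓ ∧ ¬ HasLongBanTheBomb G ℓ

/-- A candidate : a prospect with no long near-prism. -/
def Candidate (G : SimpleGraph V) (ℓ : ℕ) : Prop :=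
  Prospect G ℓ ∧ ¬ HasLongNearPrism G ℓ

/-- The vertex set of a near-prism. -/
def prismSupport {G : SimpleGraph V} {a b : Fin 3 → V}
    (P : ∀ i : Fin 3, G.Walk (a i) (b i)) : Set V :=
  ⋃ i, vset (P i)

/-- The near-prism, as a graph on `V`. -/
def prismGraph (G : SimpleGraph V) (a b : Fin 3 → V)
    (P : ∀ i : Fin 3, G.Walk (a i) (b i)) : SimpleGraph V :=
  SimpleGraph.fromEdgeSet
    ({e | ∃ i j, i ≠ j ∧ e = s(a i, a j)} ∪ {e | ∃ i j, i ≠ j ∧ e = s(b i, b j)} ∪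
      {e | ∃ i, e ∈ (P i).edges})

/-- `q` is `K`-major: `q` is outside the near-prism `K`, and no path of `K` with at most
three vertices contains all neighbours of `q` in `V(K)`. -/
def KMajor (G : SimpleGraph V) {a b : Fin 3 → V}
    (P : ∀ i : Fin 3, G.Walk (a i) (b i)) (q : V) : Prop :=
  q ∉ prismSupport P ∧
  ¬ ∃ (x y : V) (W : (prismGraph G a b P).Walk x y), W.IsPath ∧ W.length ≤ 2 ∧
      ∀ z ∈ prismSupport P, G.Adj q z → z ∈ W.support

/-- A shortest long near-prism. -/
def ShortestLNP (G : SimpleGraph V) (ℓ : ℕ) {a b : Fin 3 → V}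
    (P : ∀ i : Fin 3, G.Walk (a i) (b i)) : Prop :=
  IsLongNearPrism ℓ a b P ∧
  ∀ (a' b' : Fin 3 → V) (P' : ∀ i : Fin 3, G.Walk (a' i) (b' i)),
    IsLongNearPrism ℓ a' b' P' → (prismSupport P).ncard ≤ (prismSupport P').ncard

/-- The interior `F_K*` of the frame of a long near-prism: for each constituent path,
either the whole path (if it has length at most `ℓ-1`), or the non-end vertices of the
two stubs of length `ℓ/2 - 1` at its two ends. -/
def frameStar (ℓ : ℕ) {G : SimpleGraph V} {a b : Fin 3 → V}
    (P : ∀ i : Fin 3, G.Walk (a i) (b i)) : Set V :=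
  ⋃ i,
    if (P i).length ≤ ℓ - 1 then vset (P i)
    else {x | x ∈ (P i).support.take (ℓ / 2 - 1)} ∪
      {x | x ∈ (P i).support.reverse.take (ℓ / 2 - 1)}

/-- A long near-prism is tidy: it contains a frame (so at most one constituent path has
length at most `ℓ-1`) whose interior is anticomplete to the rest of the graph. -/
def Tidy (G : SimpleGraph V) (ℓ : ℕ) {a b : Fin 3 → V}
    (P : ∀ i : Fin 3, G.Walk (a i) (b i)) : Prop :=
  (∀ i j, (P i).length ≤ ℓ - 1 → (P j).length ≤ ℓ - 1 → i = j) ∧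
  Anticomplete G (frameStar ℓ P) {x | x ∉ prismSupport P}

/-- The index of the first neighbour of `x` in the list `l`. -/
noncomputable def firstNbrIdx (G : SimpleGraph V) (l : List V) (x : V) : ℕ :=
  l.findIdx (fun y => decide (G.Adj x y))

/-- `α(x)`: the neighbour of `x` on `P` nearest to the first end of `P`. -/
noncomputable def alpha (G : SimpleGraph V) {u w : V} (P : G.Walk u w) (x : V) : V :=
  P.support.getD (firstNbrIdx G P.support x) u

/-- `β(x)`: the neighbour of `x` on `P` nearest to the last end of `P`. -/
noncomputable def beta (G : SimpleGraph V) {u w : V} (P : G.Walk u w) (x : V) : V :=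
  P.support.reverse.getD (firstNbrIdx G P.support.reverse x) w

/-- `A(x)`: the vertex set of the subpath of `P` from its first end to `α(x)` if `x` has
a neighbour on `P`, and all of `V(P)` otherwise. -/
noncomputable def Aset (G : SimpleGraph V) {u w : V} (P : G.Walk u w) (x : V) : Set V :=
  if ∃ y ∈ P.support, G.Adj x y then
    {z | z ∈ P.support.take (firstNbrIdx G P.support x + 1)}
  else vset P

noncomputable def A123 (G : SimpleGraph V) {a b : Fin 3 → V}
    (P : ∀ i : Fin 3, G.Walk (a i) (b i)) (x : V) : Set V :=
  ⋃ i, Aset G (P i) x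

/-- The index of `v` in the list `l`. -/
noncomputable def listIdx (l : List V) (v : V) : ℕ :=
  l.findIdx (fun z => decide (z = v))

/-- `K^m_n(v)`: the union of the maximal subpath of `P` from `v` towards the first end of
`P` of length at most `m` with no internal vertex in `Fs`, and the maximal subpath of `P`
from `v` towards the last end of `P` of length at most `n` with no internal vertex in `Fs`. -/
noncomputable def Kmn (G : SimpleGraph V) (Fs : Set V) {u w : V}
    (P : G.Walk u w) (v : V) (m n : ℕ) : Set V :=
  let t := listIdx P.support v
  {z | ∃ r, r ≤ t ∧ t - r ≤ m ∧
      (∀ q, r < q → q < t → P.support.getD q v ∉ Fs) ∧ z = P.support.getD r v} ∪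
  {z | ∃ r, t ≤ r ∧ r < P.support.length ∧ r - t ≤ n ∧
      (∀ q, t < q → q < r → P.support.getD q v ∉ Fs) ∧ z = P.support.getD r v}

/-- `y` is distant from `x` (both `K`-major), for a tidy near-prism. -/
def Distant (G : SimpleGraph V) (ℓ : ℕ) {a b : Fin 3 → V}
    (P : ∀ i : Fin 3, G.Walk (a i) (b i)) (x y : V) : Prop :=
  ¬ G.Adj x y ∧
  (∃ z ∈ A123 G P x, G.Adj y z) ∧
  (∀ i, (∃ z ∈ (P i).support, G.Adj x z) →
    ∀ z ∈ Kmn G (frameStar ℓ P) (P i) (alpha G (P i) x) (ℓ - 2) 1, ¬ G.Adj y z) ∧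
  (∀ i, (¬ ∃ z ∈ (P i).support, G.Adj x z) →
    ∃ j, j ≠ i ∧
      ∀ z ∈ Kmn G (frameStar ℓ P) (P j) (beta G (P j) x) 0 (ℓ - 3), ¬ G.Adj y z)

/-- The hole `c`, regarded as a graph on `V`. -/
def holeGraph (G : SimpleGraph V) {u : V} (c : G.Walk u u) : SimpleGraph V :=
  SimpleGraph.fromEdgeSet {e | e ∈ c.edges}

/-- The distance between two vertices in the hole `c`. -/
noncomputable def holeDist (G : SimpleGraph V) {u : V} (c : G.Walk u u) (x y : V) : ℕ :=
  (holeGraph G c).dist x y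

/-- `x` is `C`-major for the hole `c`: `x` is not on `c` and no path of `c` with at most
three vertices contains all neighbours of `x` on `c`. -/
def CMajor (G : SimpleGraph V) {u : V} (c : G.Walk u u) (x : V) : Prop :=
  x ∉ c.support ∧
  ¬ ∃ q ∈ c.support, ∀ z ∈ c.support, G.Adj x z → z = q ∨ s(q, z) ∈ c.edges

/-- A shortest long even hole. -/
def ShortestLEH (G : SimpleGraph V) (ℓ : ℕ) {u : V} (c : G.Walk u u) : Prop :=
  IsLongEvenHole ℓ c ∧
  ∀ (v : V) (c' : G.Walk v v), IsLongEvenHole ℓ c' → c.length ≤ c'.length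

/-- `L₁, L₂` are the two `x y`-paths of the hole `c`. -/
def ArcPair {G : SimpleGraph V} {u : V} (c : G.Walk u u) {x y : V}
    (L₁ L₂ : G.Walk x y) : Prop :=
  L₁.IsPath ∧ L₂.IsPath ∧
  (∀ e ∈ L₁.edges, e ∈ c.edges) ∧ (∀ e ∈ L₂.edges, e ∈ c.edges) ∧
  (∀ e ∈ c.edges, e ∈ L₁.edges ∨ e ∈ L₂.edges) ∧
  (∀ e ∈ L₁.edges, e ∉ L₂.edges)

/-- `X` is lighter than `Y`, with respect to the linear order on edges given by `idx`. -/
def Lighter [DecidableEq V] (idx : Sym2 V → ℕ) (X Y : Finset (Sym2 V)) : Prop :=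
  X.card < Y.card ∨
  (X.card = Y.card ∧ ∃ e ∈ Y, e ∉ X ∧
    ∀ f : Sym2 V, ((f ∈ X ∧ f ∉ Y) ∨ (f ∈ Y ∧ f ∉ X)) → idx e ≤ idx f)

/-- The lightest long even hole. -/
def LightestLEH [DecidableEq V] (G : SimpleGraph V) (ℓ : ℕ) (idx : Sym2 V → ℕ)
    {u : V} (c : G.Walk u u) : Prop :=
  IsLongEvenHole ℓ c ∧
  ∀ (v : V) (c' : G.Walk v v), IsLongEvenHole ℓ c' →
    c'.edges.toFinset ≠ c.edges.toFinset →
    Lighter idx c.edges.toFinset c'.edges.toFinset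

/-- A `(C,x)`-gap: a path of the hole `c` of length at least two whose ends are adjacent
to `x` and none of whose interior vertices is adjacent to `x`. -/
def IsGap (G : SimpleGraph V) {u : V} (c : G.Walk u u) (x : V) {p₁ p₂ : V}
    (P : G.Walk p₁ p₂) : Prop :=
  P.IsPath ∧ (∀ e ∈ P.edges, e ∈ c.edges) ∧ 2 ≤ P.length ∧
  G.Adj x p₁ ∧ G.Adj x p₂ ∧ ∀ z ∈ inter P, ¬ G.Adj x z

end LEH

open LEH

namespace LEH

variable {V : Type*} {G : SimpleGraph V}

/-- The vertices `f 0, …, f (N - 1)` form, in this order, a hole of length `N`. -/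
structure HoleFun (G : SimpleGraph V) (f : ℕ → V) (N : ℕ) : Prop where
  four_le : 4 ≤ N
  ne : ∀ i j, i < j → j < N → f i ≠ f j
  adj : ∀ i j, i < j → j < N → (G.Adj (f i) (f j) ↔ j = i + 1 ∨ (i = 0 ∧ j + 1 = N))

/-- The vertices `f 0, …, f b` form, in this order, an induced path. -/
structure Strand (G : SimpleGraph V) (f : ℕ → V) (b : ℕ) : Prop where
  inj : ∀ i j, i ≤ b → j ≤ b → f i = f j → i = j
  adj : ∀ i j, i ≤ b → j ≤ b → (G.Adj (f i) (f j) ↔ i + 1 = j ∨ j + 1 = i)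

/-- The `n`-periodic sequence `c` runs around a hole of length `n`. -/
structure Ring (G : SimpleGraph V) (c : ℤ → V) (n : ℕ) : Prop where
  four_le : 4 ≤ n
  per : ∀ i, c (i + n) = c i
  inj : ∀ i j : ℤ, i - j < n → j - i < n → c i = c j → i = j
  adj : ∀ i j : ℤ, i - j < n → j - i < n →
    (G.Adj (c i) (c j) ↔ i - j = 1 ∨ j - i = 1 ∨ i - j = n - 1 ∨ j - i = n - 1)

theorem isHole_of_holeFun {x : V} (W : G.Walk x x) (h : HoleFun G W.getVert W.length) :
    IsHole W := by
  have h4 := h.four_le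
  have hend : W.getVert W.length = W.getVert 0 := by simp
  have key : ∀ i j, i < j → j ≤ W.length → W.getVert i = W.getVert j → i = 0 ∧ j = W.length := by
    intro i j hij hj he
    rcases Nat.lt_or_ge j W.length with h1 | h1
    · exact absurd he (h.ne i j hij h1)
    · have hjl : j = W.length := by omega
      subst hjl
      rcases Nat.eq_zero_or_pos i with h0 | h0
      · exact ⟨h0, rfl⟩
      · rw [hend] at he
        exact absurd he.symm (h.ne 0 i h0 hij)
  refine ⟨?_, h4, ?_⟩
  · cases W with
    | nil => simp at h4
    | cons hadj q =>
      rw [Walk.cons_isCycle_iff]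
      have hlen : (Walk.cons hadj q).length = q.length + 1 := by simp
      constructor
      · rw [← Walk.IsPath.getVert_injOn_iff]
        intro i hi j hj he
        simp only [Set.mem_ofPred_eq] at hi hj
        rcases lt_trichotomy i j with h1 | h1 | h1
        · have := key (i + 1) (j + 1) (by omega) (by omega) (by simpa using he)
          omega
        · exact h1
        · have := key (j + 1) (i + 1) (by omega) (by omega) (by simpa using he.symm)
          omega
      · rw [Walk.mk_mem_edges_iff_exists]
        rintro ⟨i, hi, he⟩
        have e1 : (Walk.cons hadj q).getVert (i + 1) = q.getVert i := by simp
        have e2 : (Walk.cons hadj q).getVert (i + 1 + 1) = q.getVert (i + 1) := by simp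
        have e3 : (Walk.cons hadj q).getVert 0 = x := by simp
        have e4 : (Walk.cons hadj q).getVert 1 = q.getVert 0 := by
          simp
        rw [Sym2.eq_iff] at he
        rcases he with ⟨ha, hb⟩ | ⟨ha, hb⟩
        · have := key 0 (i + 1) (by omega) (by omega) (by rw [e1, e3, ha])
          omega
        · have := key 0 (i + 1 + 1) (by omega) (by omega) (by rw [e2, e3, hb])
          have h5 : q.getVert i = q.getVert 0 := by rw [ha]; simp
          rcases Nat.eq_zero_or_pos i with h0 | h0
          · omega
          · have := key 1 (i + 1) (by omega) (by omega) (by rw [e1, e4, h5])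
            omega
  · have main : ∀ i j, i < j → j < W.length → G.Adj (W.getVert i) (W.getVert j) →
        s(W.getVert i, W.getVert j) ∈ W.edges := by
      intro i j hij hj ha
      rw [Walk.mk_mem_edges_iff_exists]
      rcases (h.adj i j hij hj).1 ha with h1 | ⟨h1, h2⟩
      · exact ⟨i, by omega, by rw [h1]⟩
      · refine ⟨j, hj, ?_⟩
        rw [h2, hend, h1, Sym2.eq_swap]
    have norm : ∀ z ∈ W.support, ∃ i, i < W.length ∧ W.getVert i = z := by
      intro z hz
      obtain ⟨i, rfl, hi⟩ := Walk.mem_support_iff_exists_getVert.1 hz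
      rcases Nat.lt_or_ge i W.length with h1 | h1
      · exact ⟨i, h1, rfl⟩
      · exact ⟨0, by omega, by rw [← hend, show i = W.length by omega]⟩
    intro y hy z hz ha
    obtain ⟨i, hi, rfl⟩ := norm y hy
    obtain ⟨j, hj, rfl⟩ := norm z hz
    rcases lt_trichotomy i j with h1 | h1 | h1
    · exact main i j h1 hj ha
    · subst h1; exact absurd ha (G.loopless.irrefl _)
    · rw [Sym2.eq_swap]; exact main j i h1 hi ha.symm

theorem exists_walk_of_adj (a : ℕ) (f : ℕ → V) (h : ∀ i < a, G.Adj (f i) (f (i + 1))) :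
    ∃ W : G.Walk (f 0) (f a), W.length = a ∧ ∀ i ≤ a, W.getVert i = f i := by
  induction a generalizing f with
  | zero => exact ⟨Walk.nil, rfl, fun i hi => by simp [show i = 0 by omega]⟩
  | succ a ih =>
    obtain ⟨W, hW, hv⟩ := ih (fun i => f (i + 1)) (fun i hi => h (i + 1) (by omega))
    refine ⟨Walk.cons (h 0 (by omega)) W, by simp [hW], ?_⟩
    intro i hi
    cases i with
    | zero => simp
    | succ i => simpa using hv i (by omega)

theorem HoleFun.exists_isHole {f : ℕ → V} {N : ℕ} (h : HoleFun G f N) :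
    ∃ W : G.Walk (f 0) (f 0), IsHole W ∧ W.length = N ∧
      ∀ z, z ∈ W.support ↔ ∃ i < N, f i = z := by
  have h4 := h.four_le
  obtain ⟨W, hW, hv⟩ := exists_walk_of_adj (G := G) N (fun i => if i < N then f i else f 0) (by
    intro i hi
    rcases Nat.lt_or_ge (i + 1) N with h1 | h1
    · simpa [hi, h1] using (h.adj i (i + 1) (by omega) h1).2 (Or.inl rfl)
    · have : i = N - 1 := by omega
      simpa [hi, show ¬ i + 1 < N by omega] using
        ((h.adj 0 i (by omega) hi).2 (Or.inr ⟨rfl, by omega⟩)).symm)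
  have e0 : (if 0 < N then f 0 else f 0) = f 0 := by simp
  have eN : (if N < N then f N else f 0) = f 0 := by simp
  have hlen : (W.copy e0 eN).length = N := by simpa using hW
  have hv' : ∀ i < N, (W.copy e0 eN).getVert i = f i := by
    intro i hi
    rw [Walk.getVert_copy, hv i hi.le]
    simp [hi]
  refine ⟨W.copy e0 eN, isHole_of_holeFun _ ⟨by omega, ?_, ?_⟩, hlen, ?_⟩
  · intro i j hij hj
    rw [hlen] at hj
    rw [hv' i (by omega), hv' j hj]
    exact h.ne i j hij hj
  · intro i j hij hj
    rw [hlen] at hj ⊢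
    rw [hv' i (by omega), hv' j hj]
    exact h.adj i j hij hj
  · intro z
    rw [Walk.mem_support_iff_exists_getVert]
    constructor
    · rintro ⟨i, rfl, hi⟩
      rcases Nat.lt_or_ge i N with h1 | h1
      · exact ⟨i, h1, (hv' i h1).symm⟩
      · refine ⟨0, by omega, ?_⟩
        rw [show i = (W.copy e0 eN).length by omega, Walk.getVert_length]
    · rintro ⟨i, hi, rfl⟩
      exact ⟨i, hv' i hi, by omega⟩

theorem Strand.exists_isInducedPath {f : ℕ → V} {b : ℕ} (h : Strand G f b) :
    ∃ W : G.Walk (f 0) (f b), IsInducedPath W ∧ W.length = b ∧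
      ∀ z, z ∈ W.support ↔ ∃ i ≤ b, f i = z := by
  obtain ⟨W, hW, hv⟩ := exists_walk_of_adj (G := G) b f
    (fun i hi => (h.adj i (i + 1) (by omega) (by omega)).2 (Or.inl rfl))
  have hsupp : ∀ z, z ∈ W.support ↔ ∃ i ≤ b, f i = z := by
    intro z
    rw [Walk.mem_support_iff_exists_getVert]
    constructor
    · rintro ⟨i, rfl, hi⟩
      exact ⟨i, by omega, (hv i (by omega)).symm⟩
    · rintro ⟨i, hi, rfl⟩
      exact ⟨i, hv i hi, by omega⟩
  refine ⟨W, ⟨?_, ?_⟩, hW, hsupp⟩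
  · rw [← Walk.IsPath.getVert_injOn_iff]
    intro i hi j hj he
    simp only [Set.mem_ofPred_eq] at hi hj
    rw [hv i (by omega), hv j (by omega)] at he
    exact h.inj i j (by omega) (by omega) he
  · intro y hy z hz ha
    obtain ⟨i, hi, rfl⟩ := (hsupp y).1 hy
    obtain ⟨j, hj, rfl⟩ := (hsupp z).1 hz
    rw [Walk.mk_mem_edges_iff_exists]
    rcases (h.adj i j hi hj).1 ha with h1 | h1
    · exact ⟨i, by omega, by rw [hv i hi, hv (i + 1) (by omega), h1]⟩
    · exact ⟨j, by omega, by rw [hv j hj, hv (j + 1) (by omega), h1, Sym2.eq_swap]⟩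

namespace Strand

theorem shift {f : ℕ → V} {b : ℕ} (h : Strand G f b) (s b' : ℕ) (hb : s + b' ≤ b) :
    Strand G (fun i => f (s + i)) b' where
  inj i j hi hj he := by
    have := h.inj _ _ (by omega) (by omega) he
    omega
  adj i j hi hj := by
    rw [h.adj _ _ (by omega) (by omega)]
    omega

/-- Adding two nonadjacent end vertices to an induced path. -/
theorem cap {f : ℕ → V} {b : ℕ} (h : Strand G f b) {x y : V} (hxy : x ≠ y) (hna : ¬ G.Adj x y)
    (hx : ∀ i ≤ b, f i ≠ x) (hy : ∀ i ≤ b, f i ≠ y)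
    (hax : ∀ i ≤ b, (G.Adj x (f i) ↔ i = 0)) (hay : ∀ i ≤ b, (G.Adj y (f i) ↔ i = b)) :
    Strand G (fun i => if i = 0 then x else if i ≤ b + 1 then f (i - 1) else y) (b + 2) where
  inj i j hi hj he := by
    split_ifs at he with h1 h2 h3 h4 h5 h6 h7 h8
    · omega
    · exact absurd he.symm (hx _ (by omega))
    · exact absurd he hxy
    · exact absurd he (hx _ (by omega))
    · have := h.inj _ _ (by omega) (by omega) he
      omega
    · exact absurd he (hy _ (by omega))
    · exact absurd he.symm hxy
    · exact absurd he.symm (hy _ (by omega))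
    · omega
  adj i j hi hj := by
    split_ifs with h1 h2 h3 h4 h5 h6 h7 h8
    · simp only [SimpleGraph.irrefl, false_iff]; omega
    · rw [hax _ (by omega)]; omega
    · simp only [hna, false_iff]; omega
    · rw [G.adj_comm, hax _ (by omega)]; omega
    · rw [h.adj _ _ (by omega) (by omega)]; omega
    · rw [G.adj_comm, hay _ (by omega)]; omega
    · rw [G.adj_comm]; simp only [hna, false_iff]; omega
    · rw [hay _ (by omega)]; omega
    · simp only [SimpleGraph.irrefl, false_iff]; omega

/-- Two anticomplete-up-to-their-ends induced paths whose corresponding ends are adjacent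
form a hole. -/
theorem holeFun {s t : ℕ → V} {a b : ℕ} (hs : Strand G s a) (ht : Strand G t b)
    (h4 : 4 ≤ a + b + 2) (hne : ∀ i ≤ a, ∀ j ≤ b, s i ≠ t j)
    (hadj : ∀ i ≤ a, ∀ j ≤ b, (G.Adj (s i) (t j) ↔ (i = 0 ∧ j = 0) ∨ (i = a ∧ j = b))) :
    HoleFun G (fun i => if i ≤ a then s i else t (b - (i - (a + 1)))) (a + b + 2) where
  four_le := h4
  ne i j hij hj := by
    split_ifs with h1 h2 h2
    · intro he
      have := hs.inj _ _ (by omega) (by omega) he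
      omega
    · exact hne _ h1 _ (by omega)
    · omega
    · intro he
      have := ht.inj _ _ (by omega) (by omega) he
      omega
  adj i j hij hj := by
    split_ifs with h1 h2 h2
    · rw [hs.adj _ _ (by omega) (by omega)]; omega
    · rw [hadj _ h1 _ (by omega)]; omega
    · omega
    · rw [ht.adj _ _ (by omega) (by omega)]; omega

end Strand

theorem HoleFun.ring {f : ℕ → V} {N : ℕ} (h : HoleFun G f N) :
    Ring G (fun z => f (z % N).toNat) N := by
  have h4 := h.four_le
  have hb : ∀ z : ℤ, 0 ≤ z % (N : ℤ) ∧ z % (N : ℤ) < N := fun z =>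
    ⟨Int.emod_nonneg _ (by omega), Int.emod_lt_of_pos _ (by omega)⟩
  have hdiff : ∀ i j : ℤ, i - j < N → j - i < N →
      i - j = i % N - j % N ∨ i - j = i % N - j % N + N ∨ i - j = i % N - j % N - N := by
    intro i j h1 h2
    have e1 := Int.mul_ediv_add_emod i N
    have e2 := Int.mul_ediv_add_emod j N
    have hi := hb i
    have hj := hb j
    have e3 : (N : ℤ) * (i / N - j / N) = (i - j) - (i % N - j % N) := by linarith
    have h5 : i / (N : ℤ) - j / N < 2 := by nlinarith
    have h6 : -2 < i / (N : ℤ) - j / N := by nlinarith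
    generalize hq : i / (N : ℤ) - j / N = q at *
    have : q = -1 ∨ q = 0 ∨ q = 1 := by omega
    rcases this with rfl | rfl | rfl <;> omega
  refine ⟨h4, fun i => by simp, ?_, ?_⟩
  · intro i j h1 h2 he
    have hi := hb i
    have hj := hb j
    have hd := hdiff i j h1 h2
    rcases lt_trichotomy (i % N).toNat (j % N).toNat with h3 | h3 | h3
    · exact absurd he (h.ne _ _ h3 (by omega))
    · omega
    · exact absurd he.symm (h.ne _ _ h3 (by omega))
  · intro i j h1 h2
    have hi := hb i
    have hj := hb j
    have hd := hdiff i j h1 h2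
    rcases lt_trichotomy (i % N).toNat (j % N).toNat with h3 | h3 | h3
    · rw [h.adj _ _ h3 (by omega)]; omega
    · rw [h3]; simp only [SimpleGraph.irrefl, false_iff]; omega
    · rw [G.adj_comm, h.adj _ _ h3 (by omega)]; omega

/-- The cyclic sequence of vertices of a hole. -/
theorem IsHole.ring {u : V} {c : G.Walk u u} (h : IsHole c) :
    Ring G (fun z => c.getVert (z % c.length).toNat) c.length := by
  obtain ⟨hcyc, h4, hch⟩ := h
  have hinj : ∀ i j, i < c.length → j < c.length → c.getVert i = c.getVert j → i = j :=
    fun i j hi hj he => hcyc.getVert_injOn' (by simp only [Set.mem_ofPred_eq]; omega)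
      (by simp only [Set.mem_ofPred_eq]; omega) he
  have hend : c.getVert c.length = c.getVert 0 := by simp
  refine HoleFun.ring ⟨h4, ?_, ?_⟩
  · intro i j hij hj he
    have := hinj i j (by omega) hj he
    omega
  · intro i j hij hj
    constructor
    · intro ha
      have := hch _ (c.getVert_mem_support i) _ (c.getVert_mem_support j) ha
      rw [Walk.mk_mem_edges_iff_exists] at this
      obtain ⟨l, hl, he⟩ := this
      rw [Sym2.eq_iff] at he
      rcases Nat.lt_or_ge (l + 1) c.length with h1 | h1
      · rcases he with ⟨ha, hb⟩ | ⟨ha, hb⟩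
        · have := hinj _ _ hl (by omega) ha
          have := hinj _ _ h1 (by omega) hb
          omega
        · have := hinj _ _ hl (by omega) ha
          have := hinj _ _ h1 (by omega) hb
          omega
      · rw [show l + 1 = c.length by omega, hend] at he
        rcases he with ⟨ha, hb⟩ | ⟨ha, hb⟩
        · have := hinj _ _ hl (by omega) ha
          have := hinj _ _ (by omega) (by omega) hb
          omega
        · have := hinj _ _ hl (by omega) ha
          have := hinj _ _ (by omega) (by omega) hb
          omega
    · rintro (h1 | ⟨h1, h2⟩)
      · rw [h1]; exact c.adj_getVert_succ (by omega)
      · have := c.adj_getVert_succ hj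
        rw [h2, hend] at this
        rw [h1]; exact this.symm

theorem IsHole.mem_support_iff {u : V} {c : G.Walk u u} (h : IsHole c) (v : V) :
    v ∈ c.support ↔ ∃ z : ℤ, c.getVert (z % c.length).toNat = v := by
  have h4 := h.2.1
  constructor
  · intro hv
    obtain ⟨i, rfl, hi⟩ := Walk.mem_support_iff_exists_getVert.1 hv
    rcases Nat.lt_or_ge i c.length with h1 | h1
    · refine ⟨i, ?_⟩
      rw [Int.emod_eq_of_lt (by omega) (by omega)]
      simp
    · refine ⟨0, ?_⟩
      rw [show i = c.length by omega]
      simp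
  · rintro ⟨z, rfl⟩
    exact c.getVert_mem_support _

namespace Ring

variable {c : ℤ → V} {n : ℕ}

theorem per_mul (h : Ring G c n) (i q : ℤ) : c (i + n * q) = c i := by
  induction q using Int.induction_on with
  | zero => simp
  | succ q ih => rw [← ih, ← h.per (i + n * q)]; congr 1; ring
  | pred q ih => rw [← ih, ← h.per (i + n * (-q - 1))]; congr 1; ring

theorem exists_window (h : Ring G c n) (e i : ℤ) : ∃ j, e ≤ j ∧ j < e + n ∧ c j = c i := by
  have h4 := h.four_le
  refine ⟨e + (i - e) % n, ?_, ?_, ?_⟩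
  · have := Int.emod_nonneg (i - e) (show (n : ℤ) ≠ 0 by omega)
    omega
  · have := Int.emod_lt_of_pos (i - e) (show (0 : ℤ) < n by omega)
    omega
  · rw [← h.per_mul _ ((i - e) / n)]
    have := Int.mul_ediv_add_emod (i - e) n
    congr 1
    linarith

theorem add_of_eq (h : Ring G c n) {i j : ℤ} (he : c i = c j) (x : ℤ) : c (i + x) = c (j + x) := by
  obtain ⟨q, hq⟩ : ∃ q : ℤ, i = j + n * q := by
    have h4 := h.four_le
    have e1 := Int.mul_ediv_add_emod (i - j) n
    have h1 := Int.emod_nonneg (i - j) (show (n : ℤ) ≠ 0 by omega)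
    have h2 := Int.emod_lt_of_pos (i - j) (show (0 : ℤ) < n by omega)
    refine ⟨(i - j) / n, ?_⟩
    have e2 : c (j + (i - j) % n) = c j := by
      rw [← he, ← h.per_mul _ ((i - j) / n)]
      congr 1
      linarith
    have := h.inj _ _ (by omega) (by omega) e2
    omega
  rw [hq, ← h.per_mul (j + x) q]
  congr 1
  ring

theorem shift (h : Ring G c n) (x : ℤ) : Ring G (fun i => c (i + x)) n where
  four_le := h.four_le
  per i := by
    rw [← h.per (i + x)]
    congr 1
    ring
  inj i j h1 h2 he := by
    have := h.inj _ _ (by omega) (by omega) he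
    omega
  adj i j h1 h2 := by
    rw [h.adj _ _ (by omega) (by omega)]
    omega

theorem reflect (h : Ring G c n) : Ring G (fun i => c (-i)) n where
  four_le := h.four_le
  per i := by
    rw [← h.per]
    congr 1
    ring
  inj i j h1 h2 he := by
    have := h.inj _ _ (by omega) (by omega) he
    omega
  adj i j h1 h2 := by
    rw [h.adj _ _ (by omega) (by omega)]
    omega

theorem strand (h : Ring G c n) (e : ℤ) (b : ℕ) (hb : b + 2 ≤ n) :
    Strand G (fun i => c (e + i)) b where
  inj i j hi hj he := by
    have := h.inj _ _ (by omega) (by omega) he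
    omega
  adj i j hi hj := by
    rw [h.adj _ _ (by omega) (by omega)]
    omega

theorem strand_neg (h : Ring G c n) (e : ℤ) (b : ℕ) (hb : b + 2 ≤ n) :
    Strand G (fun i => c (e - i)) b where
  inj i j hi hj he := by
    have := h.inj _ _ (by omega) (by omega) he
    omega
  adj i j hi hj := by
    rw [h.adj _ _ (by omega) (by omega)]
    omega

end Ring

variable {ℓ : ℕ}

/-- The vertices `t 0, …, t b` are the interior, in this order, of an induced path from `x`
to `y`, where `x`, `y` are distinct and nonadjacent. -/
structure Link (G : SimpleGraph V) (x y : V) (t : ℕ → V) (b : ℕ) : Prop where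
  ends_ne : x ≠ y
  ends_adj : ¬ G.Adj x y
  strand : Strand G t b
  ne_left : ∀ i ≤ b, t i ≠ x
  ne_right : ∀ i ≤ b, t i ≠ y
  left : ∀ i ≤ b, (G.Adj x (t i) ↔ i = 0)
  right : ∀ i ≤ b, (G.Adj y (t i) ↔ i = b)

theorem Link.exists_isInducedPath {x y : V} {t : ℕ → V} {b : ℕ} (h : Link G x y t b) :
    ∃ P : G.Walk x y, IsInducedPath P ∧ P.length = b + 2 ∧
      ∀ z, z ∈ inter P → ∃ i ≤ b, t i = z := by
  have hs := h.strand.cap h.ends_ne h.ends_adj h.ne_left h.ne_right h.left h.right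
  generalize hf : (fun i => if i = 0 then x else if i ≤ b + 1 then t (i - 1) else y) = f at hs
  obtain ⟨W, hW, hlen, hsupp⟩ := hs.exists_isInducedPath
  have e0 : f 0 = x := by simp [← hf]
  have e1 : f (b + 2) = y := by simp [← hf]
  have e2 : ∀ i, 1 ≤ i → i ≤ b + 1 → f i = t (i - 1) := by
    intro i h1 h2
    simp [← hf, show i ≠ 0 by omega, h2]
  clear hf
  subst e0 e1
  refine ⟨W, hW, hlen, ?_⟩
  rintro z ⟨hz, hz0, hz1⟩
  obtain ⟨i, hi, rfl⟩ := (hsupp z).1 hz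
  have h0 : i ≠ 0 := fun h => hz0 (by rw [h])
  have h1 : i ≠ b + 2 := fun h => hz1 (by rw [h])
  exact ⟨i - 1, by omega, (e2 i (by omega) (by omega)).symm⟩

/-- The vertices `s 0, …, s a` are anticomplete to `t 0, …, t b`. -/
def Apart (G : SimpleGraph V) (s : ℕ → V) (a : ℕ) (t : ℕ → V) (b : ℕ) : Prop :=
  ∀ i ≤ a, ∀ j ≤ b, s i ≠ t j ∧ ¬ G.Adj (s i) (t j)

theorem Apart.anticomplete {s t : ℕ → V} {a b : ℕ} (h : Apart G s a t b) {X Y : Set V}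
    (hX : ∀ z ∈ X, ∃ i ≤ a, s i = z) (hY : ∀ z ∈ Y, ∃ i ≤ b, t i = z) : Anticomplete G X Y := by
  intro x hx y hy
  obtain ⟨i, hi, rfl⟩ := hX x hx
  obtain ⟨j, hj, rfl⟩ := hY y hy
  exact h i hi j hj

theorem hasLongTheta_of_links {x y : V} {t₁ t₂ t₃ : ℕ → V} {b₁ b₂ b₃ : ℕ}
    (h₁ : Link G x y t₁ b₁) (h₂ : Link G x y t₂ b₂) (h₃ : Link G x y t₃ b₃)
    (h₁₂ : Apart G t₁ b₁ t₂ b₂) (h₁₃ : Apart G t₁ b₁ t₃ b₃) (h₂₃ : Apart G t₂ b₂ t₃ b₃)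
    (l₁₂ : ℓ ≤ b₁ + b₂ + 4) (l₁₃ : ℓ ≤ b₁ + b₃ + 4) (l₂₃ : ℓ ≤ b₂ + b₃ + 4) :
    HasLongTheta G ℓ := by
  obtain ⟨P₁, i₁, e₁, m₁⟩ := h₁.exists_isInducedPath
  obtain ⟨P₂, i₂, e₂, m₂⟩ := h₂.exists_isInducedPath
  obtain ⟨P₃, i₃, e₃, m₃⟩ := h₃.exists_isInducedPath
  exact ⟨x, y, P₁, P₂, P₃, h₁.ends_ne, h₁.ends_adj, i₁, i₂, i₃, h₁₂.anticomplete m₁ m₂,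
    h₁₃.anticomplete m₁ m₃, h₂₃.anticomplete m₂ m₃, by omega, by omega, by omega⟩

theorem hasLongJewel_of_links {x y : V} {t₁ t₂ t₃ : ℕ → V} {b₁ b₂ b₃ : ℕ}
    (h₁ : Link G x y t₁ b₁) (h₂ : Link G x y t₂ b₂) (h₃ : Link G x y t₃ b₃)
    (h₁₃ : Apart G t₃ b₃ t₁ b₁) (h₂₃ : Apart G t₃ b₃ t₂ b₂) (hodd : Odd (b₁ + b₂))
    (l₁ : b₁ + 2 ≤ ℓ) (l₂ : b₂ + 2 ≤ ℓ) (l₁₃ : ℓ ≤ b₃ + b₁ + 4) (l₂₃ : ℓ ≤ b₃ + b₂ + 4) :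
    ∃ k ≤ ℓ + 1, HasLongJewel G ℓ k := by
  obtain ⟨P₁, i₁, e₁, m₁⟩ := h₁.exists_isInducedPath
  obtain ⟨P₂, i₂, e₂, m₂⟩ := h₂.exists_isInducedPath
  obtain ⟨P₃, i₃, e₃, m₃⟩ := h₃.exists_isInducedPath
  refine ⟨_, ?_, x, y, P₁, P₂, P₃, h₁.ends_ne, i₁, i₂, i₃, ?_, rfl, ?_, ?_⟩
  · simp only [Walk.length_support]
    omega
  · rw [Nat.odd_iff] at hodd
    simp only [Nat.even_iff]
    omega
  · omega
  · rintro z hz w (hw | hw)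
    · exact h₁₃.anticomplete m₃ m₁ hz hw
    · exact h₂₃.anticomplete m₃ m₂ hz hw

/-- Two disjoint paths whose only connecting edges join the first vertices
and join the last vertices. -/
structure Rung (G : SimpleGraph V) (s : ℕ → V) (a : ℕ) (t : ℕ → V) (b : ℕ) : Prop where
  ne : ∀ i ≤ a, ∀ j ≤ b, s i ≠ t j
  adj : ∀ i ≤ a, ∀ j ≤ b, (G.Adj (s i) (t j) ↔ (i = 0 ∧ j = 0) ∨ (i = a ∧ j = b))

theorem Rung.symm {s t : ℕ → V} {a b : ℕ} (h : Rung G s a t b) : Rung G t b s a where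
  ne i hi j hj he := h.ne j hj i hi he.symm
  adj i hi j hj := by
    rw [G.adj_comm, h.adj j hj i hi]
    tauto

theorem hasLongNearPrism_of_strands (hℓ : 4 ≤ ℓ) (s : Fin 3 → ℕ → V) (b : Fin 3 → ℕ)
    (hs : ∀ i, Strand G (s i) (b i)) (hr : ∀ i j, i < j → Rung G (s i) (b i) (s j) (b j))
    (hl : ∀ i j, i < j → ℓ ≤ b i + b j + 2) : HasLongNearPrism G ℓ := by
  have hr' : ∀ i j, i ≠ j → Rung G (s i) (b i) (s j) (b j) := by
    intro i j hij
    rcases lt_or_gt_of_ne hij with h | h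
    · exact hr i j h
    · exact (hr j i h).symm
  have hl' : ∀ i j, i ≠ j → ℓ ≤ b i + b j + 2 := by
    intro i j hij
    rcases lt_or_gt_of_ne hij with h | h
    · exact hl i j h
    · have := hl j i h
      omega
  choose P hP hlen hsupp using fun i => (hs i).exists_isInducedPath
  refine ⟨fun i => s i 0, fun i => s i (b i), P, ?_, ?_, ?_, fun i => (hP i).1, ?_, ?_⟩
  · intro i j hij
    exact ((hr' i j hij).adj 0 (by omega) 0 (by omega)).2 (Or.inl ⟨rfl, rfl⟩)
  · intro i j hij
    exact ((hr' i j hij).adj _ le_rfl _ le_rfl).2 (Or.inr ⟨rfl, rfl⟩)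
  · have key : ∀ i j, s i 0 = s j (b j) → i = j ∧ b i = 0 := by
      intro i j he
      by_cases hij : i = j
      · subst hij
        exact ⟨rfl, ((hs i).inj _ _ (by omega) le_rfl he).symm⟩
      · exact absurd he ((hr' i j hij).ne _ (by omega) _ le_rfl)
    rintro x ⟨⟨i, rfl⟩, ⟨j, hj⟩⟩ y ⟨⟨i', rfl⟩, ⟨j', hj'⟩⟩
    have h1 := key i j hj.symm
    have h2 := key i' j' hj'.symm
    by_cases hii : i = i'
    · rw [hii]
    · have := hl' i i' hii
      omega
  · intro i j hij x hx hx'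
    obtain ⟨k, hk, rfl⟩ := (hsupp i _).1 hx
    obtain ⟨l, hl, he⟩ := (hsupp j _).1 hx'
    exact (hr' i j hij).ne k hk l hl he.symm
  · intro i j hij
    have h1 := hl' i j hij
    obtain ⟨W, hW, hWl, hWs⟩ := ((hs i).holeFun (hs j) (by omega) (hr' i j hij).ne
      (hr' i j hij).adj).exists_isHole
    refine ⟨_, W, hW, by omega, ?_⟩
    ext z
    simp only [vset, Set.mem_union, Set.mem_ofPred_eq, hWs, hsupp]
    constructor
    · rintro ⟨k, hk, rfl⟩
      split_ifs with h2
      · exact Or.inl ⟨k, h2, rfl⟩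
      · exact Or.inr ⟨_, by omega, rfl⟩
    · rintro (⟨k, hk, rfl⟩ | ⟨k, hk, rfl⟩)
      · exact ⟨k, by omega, by simp [hk]⟩
      · refine ⟨b i + 1 + (b j - k), by omega, ?_⟩
        rw [if_neg (by omega)]
        congr 1
        omega

theorem hasLongBanTheBomb_of_strands {u w : V} {p q : ℕ → V} {a b : ℕ}
    (hp : Strand G p a) (hq : Strand G q b) (hpq : p 0 = q 0) (ha : 2 ≤ a) (hb : 2 ≤ b)
    (huw : u ≠ w) (hneu : ∀ i ≤ a, p i ≠ u) (hnew : ∀ i ≤ a, p i ≠ w)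
    (hneu' : ∀ i ≤ b, q i ≠ u) (hnew' : ∀ i ≤ b, q i ≠ w)
    (hu : ∀ i ≤ a, (G.Adj u (p i) ↔ i = 0 ∨ i = a)) (hw : ∀ i ≤ a, (G.Adj w (p i) ↔ i = a))
    (hu' : ∀ i ≤ b, (G.Adj u (q i) ↔ i = 0 ∨ i = b)) (hw' : ∀ i ≤ b, (G.Adj w (q i) ↔ i = b))
    (hap : ∀ i ≤ a, ∀ j ≤ b, i ≠ 0 → j ≠ 0 → p i ≠ q j ∧ ¬ G.Adj (p i) (q j))
    (la : ℓ ≤ a + 2) (lb : ℓ ≤ b + 2) : HasLongBanTheBomb G ℓ := by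
  obtain ⟨P, iP, lP, sP⟩ := hp.exists_isInducedPath
  obtain ⟨Q, iQ, lQ, sQ⟩ := hq.exists_isInducedPath
  obtain ⟨x, hx⟩ : ∃ x, x = p 0 := ⟨_, rfl⟩
  have hx' : q 0 = x := by rw [hx, hpq]
  have hcop : ∀ z, z ∈ inter P → ∃ i ≤ a, i ≠ 0 ∧ i ≠ a ∧ p i = z := by
    rintro z ⟨hz, h0, h1⟩
    obtain ⟨i, hi, rfl⟩ := (sP z).1 hz
    exact ⟨i, hi, fun h => h0 (by rw [h]), fun h => h1 (by rw [h]), rfl⟩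
  have hcoq : ∀ z, z ∈ inter Q → ∃ i ≤ b, i ≠ 0 ∧ i ≠ b ∧ q i = z := by
    rintro z ⟨hz, h0, h1⟩
    obtain ⟨i, hi, rfl⟩ := (sQ z).1 hz
    exact ⟨i, hi, fun h => h0 (by rw [h]), fun h => h1 (by rw [h]), rfl⟩
  have eP : inter (P.copy hx.symm rfl) = inter P := by subst hx; rfl
  have eP' : vset (P.copy hx.symm rfl) = vset P := by subst hx; rfl
  have iP' : IsInducedPath (P.copy hx.symm rfl) := by subst hx; exact iP
  have eQ : inter (Q.copy hx' rfl) = inter Q := by subst hx'; rfl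
  have eQ' : vset (Q.copy hx' rfl) = vset Q := by subst hx'; rfl
  have iQ' : IsInducedPath (Q.copy hx' rfl) := by subst hx'; exact iQ
  have hu0 := hu 0 (by omega)
  have hw0 := hw 0 (by omega)
  have hab := hap a le_rfl b le_rfl (by omega) (by omega)
  refine ⟨u, p a, w, q b, x, P.copy hx.symm rfl, Q.copy hx' rfl, (hu a le_rfl).2 (Or.inr rfl),
    ((hw a le_rfl).2 rfl).symm, (hw' b le_rfl).2 rfl, ((hu' b le_rfl).2 (Or.inr rfl)).symm,
    hab.2, huw, ?_, ?_, ?_, ?_, ?_, ?_, ?_, iP', iQ', ?_, ?_, ?_, ?_, ?_, ?_, ?_, ?_⟩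
  · rw [hx]
    exact (hu0.2 (Or.inl rfl)).symm
  · rw [hx, hp.adj _ _ (by omega) le_rfl]; omega
  · rw [← hx', hq.adj _ _ (by omega) le_rfl]; omega
  · rw [hx, G.adj_comm, hw0]; omega
  · intro h
    have := hp.inj 0 a (by omega) le_rfl (by rw [← h, hx])
    omega
  · intro h
    have := hq.inj 0 b (by omega) le_rfl (by rw [← h, hx'])
    omega
  · rw [hx]; exact hnew 0 (by omega)
  · simpa [lP] using ha
  · simpa [lQ] using hb
  · rw [eP]
    intro z hz y hy
    obtain ⟨i, hi, h0, h1, rfl⟩ := hcop z hz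
    rcases hy with rfl | rfl
    · refine ⟨hneu i hi, ?_⟩
      rw [G.adj_comm, hu i hi]; omega
    · refine ⟨hnew i hi, ?_⟩
      rw [G.adj_comm, hw i hi]; omega
  · rw [eQ]
    intro z hz y hy
    obtain ⟨i, hi, h0, h1, rfl⟩ := hcoq z hz
    rcases hy with rfl | rfl
    · refine ⟨hneu' i hi, ?_⟩
      rw [G.adj_comm, hu' i hi]; omega
    · refine ⟨hnew' i hi, ?_⟩
      rw [G.adj_comm, hw' i hi]; omega
  · rw [eP', eQ']
    rintro z ⟨hz, hz0⟩ y ⟨hy, hy0⟩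
    obtain ⟨i, hi, rfl⟩ := (sP z).1 hz
    obtain ⟨j, hj, rfl⟩ := (sQ y).1 hy
    exact hap i hi j hj (fun h => hz0 (by rw [h, hx]; rfl)) (fun h => hy0 (by rw [h, hx']; rfl))
  · simpa [lP] using la
  · simpa [lQ] using lb
  · simp [lP, lQ]; omega

/-- Every long even hole has at least `n` vertices. -/
def NoShorter (G : SimpleGraph V) (ℓ n : ℕ) : Prop :=
  ∀ (u : V) (c : G.Walk u u), IsLongEvenHole ℓ c → n ≤ c.length

theorem NoShorter.le {n : ℕ} (h : NoShorter G ℓ n) {f : ℕ → V} {N : ℕ} (hf : HoleFun G f N)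
    (hN : Even N) (hl : ℓ ≤ N) : n ≤ N := by
  obtain ⟨W, hW, hlen, -⟩ := hf.exists_isHole
  have := h _ W ⟨hW, by omega, by rwa [hlen]⟩
  omega

theorem NoShorter.le_of_rung {n : ℕ} (h : NoShorter G ℓ n) (hℓ : 4 ≤ ℓ) {s t : ℕ → V} {a b : ℕ}
    (hs : Strand G s a) (ht : Strand G t b) (hr : Rung G s a t b) (hN : Even (a + b))
    (hl : ℓ ≤ a + b + 2) : n ≤ a + b + 2 :=
  h.le (hs.holeFun ht (by omega) hr.ne hr.adj) (by rw [Nat.even_add]; simpa using hN) hl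

/-- The path `t 0, …, t b` is the interior of an ear on the hole `δ`, attached at `δ 0` and
`δ a` and without neighbours among `δ (a + 1), …, δ (-1)`. -/
structure Ear (G : SimpleGraph V) (δ : ℤ → V) (N : ℕ) (t : ℕ → V) (a b : ℕ) : Prop where
  ring : Ring G δ N
  strand : Strand G t b
  two_le : 2 ≤ a
  le : a + 2 ≤ N
  ne : ∀ z : ℤ, ∀ j ≤ b, δ z ≠ t j
  far : ∀ y : ℕ, 1 ≤ y → y + a + 1 ≤ N → ∀ j ≤ b, ¬ G.Adj (δ (-y)) (t j)
  left : ∀ j ≤ b, (G.Adj (δ 0) (t j) ↔ j = 0)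
  right : ∀ j ≤ b, (G.Adj (δ a) (t j) ↔ j = b)
  odd : Odd (a + b)

namespace Ear

variable {δ : ℤ → V} {N : ℕ} {t : ℕ → V} {a b : ℕ}

theorem ends_ne (h : Ear G δ N t a b) : δ 0 ≠ δ a := by
  intro he
  have := h.two_le
  have := h.le
  have := h.ring.inj _ _ (by omega) (by omega) he
  omega

theorem ends_adj (h : Ear G δ N t a b) : ¬ G.Adj (δ 0) (δ a) := by
  have := h.two_le
  have := h.le
  rw [h.ring.adj _ _ (by omega) (by omega)]
  omega

theorem link_near (h : Ear G δ N t a b) : Link G (δ 0) (δ a) (fun i => δ (1 + i)) (a - 2) := by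
  have := h.two_le
  have := h.le
  refine ⟨h.ends_ne, h.ends_adj, h.ring.strand 1 _ (by omega), ?_, ?_, ?_, ?_⟩
  · intro i hi he
    have := h.ring.inj _ _ (by omega) (by omega) he
    omega
  · intro i hi he
    have := h.ring.inj _ _ (by omega) (by omega) he
    omega
  · intro i hi
    rw [h.ring.adj _ _ (by omega) (by omega)]
    omega
  · intro i hi
    rw [h.ring.adj _ _ (by omega) (by omega)]
    omega

theorem link_far (h : Ear G δ N t a b) :
    Link G (δ 0) (δ a) (fun i => δ (-1 - i)) (N - a - 2) := by
  have := h.two_le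
  have := h.le
  refine ⟨h.ends_ne, h.ends_adj, h.ring.strand_neg (-1) _ (by omega), ?_, ?_, ?_, ?_⟩
  · intro i hi he
    have := h.ring.inj _ _ (by omega) (by omega) he
    omega
  · intro i hi he
    have := h.ring.inj _ _ (by omega) (by omega) he
    omega
  · intro i hi
    rw [h.ring.adj _ _ (by omega) (by omega)]
    omega
  · intro i hi
    rw [h.ring.adj _ _ (by omega) (by omega)]
    omega

theorem link_ear (h : Ear G δ N t a b) : Link G (δ 0) (δ a) t b :=
  ⟨h.ends_ne, h.ends_adj, h.strand, fun i hi he => h.ne _ i hi he.symm,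
    fun i hi he => h.ne _ i hi he.symm, h.left, h.right⟩

theorem apart_far_ear (h : Ear G δ N t a b) :
    Apart G (fun i => δ (-1 - i)) (N - a - 2) t b := by
  intro i hi j hj
  have := h.two_le
  have := h.le
  refine ⟨h.ne _ j hj, ?_⟩
  have := h.far (i + 1) (by omega) (by omega) j hj
  rwa [show -((i + 1 : ℕ) : ℤ) = -1 - i by push_cast; ring] at this

theorem apart_far_near (h : Ear G δ N t a b) :
    Apart G (fun i => δ (-1 - i)) (N - a - 2) (fun i => δ (1 + i)) (a - 2) := by
  intro i hi j hj
  have := h.two_le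
  have := h.le
  constructor
  · intro he
    have := h.ring.inj _ _ (by omega) (by omega) he
    omega
  · rw [h.ring.adj _ _ (by omega) (by omega)]
    omega

theorem false_of_short (h : Ear G δ N t a b) (hG : Candidate G ℓ) (ha : a ≤ ℓ) (hb : b + 2 ≤ ℓ)
    (hN : ℓ ≤ N) (hN' : ℓ + a ≤ N + b + 2) : False := by
  have := h.two_le
  have := h.le
  have hodd := h.odd
  refine hG.1.2.1 (hasLongJewel_of_links h.link_near h.link_ear h.link_far h.apart_far_near
    h.apart_far_ear ?_ (by omega) (by omega) (by omega) (by omega))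
  rw [Nat.odd_iff] at *
  omega

theorem false_of_contacts (h : Ear G δ N t a b) (hG : Candidate G ℓ) (hℓ : 6 ≤ ℓ)
    (hℓe : Even ℓ) {n : ℕ} (hmin : NoShorter G ℓ n)
    (hN : ℓ ≤ N) (hN' : ℓ + a ≤ N + b + 2) (hn : a + b + 1 < n)
    (hcon : ∀ i : ℕ, 0 < i → i < a → ∀ j ≤ b, G.Adj (δ i) (t j) →
      (i = 1 ∧ j = 0) ∨ (i + 1 = a ∧ j = b)) : False := by
  have h2 := h.two_le
  have hle := h.le
  have hodd := h.odd
  rw [Nat.odd_iff] at hodd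
  rw [Nat.even_iff] at hℓe
  rcases Nat.lt_or_ge (a + b) ℓ with hs | hs
  · exact h.false_of_short hG (by omega) (by omega) hN hN'
  have cast1 : ∀ i : ℕ, (1 : ℤ) + i = ((1 + i : ℕ) : ℤ) := fun i => by push_cast; ring
  have e1 : ((1 : ℕ) : ℤ) = 1 := rfl
  have e2 : ((a - 1 : ℕ) : ℤ) = a - 1 := by push_cast [show 1 ≤ a by omega]; ring
  by_cases hL : G.Adj (δ 1) (t 0) <;> by_cases hR : G.Adj (δ (a - 1)) (t b)
  · refine hG.2 (hasLongNearPrism_of_strands (by omega)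
      ![fun i => δ (1 + i), t, fun i => δ (0 - i)] ![a - 2, b, N - a] ?_ ?_ ?_)
    · intro i
      fin_cases i
      · exact h.ring.strand 1 (a - 2) (by omega)
      · exact h.strand
      · exact h.ring.strand_neg 0 (N - a) (by omega)
    · have r01 : Rung G (fun i => δ (1 + i)) (a - 2) t b := by
        refine ⟨fun i _ j hj => h.ne _ j hj, fun i hi j hj => ?_⟩
        constructor
        · intro hA
          rw [cast1] at hA
          have := hcon _ (by omega) (by omega) j hj hA
          omega
        · rintro (⟨rfl, rfl⟩ | ⟨rfl, rfl⟩)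
          · simpa using hL
          · rw [← e2] at hR
            rw [cast1, show 1 + (a - 2) = a - 1 by omega]
            exact hR
      have r02 : Rung G (fun i => δ (1 + i)) (a - 2) (fun i => δ (0 - i)) (N - a) := by
        refine ⟨fun i _ j hj he => ?_, fun i hi j hj => ?_⟩
        · have := h.ring.inj _ _ (by omega) (by omega) he
          omega
        · rw [h.ring.adj _ _ (by omega) (by omega)]
          omega
      have r12 : Rung G t b (fun i => δ (0 - i)) (N - a) := by
        refine Rung.symm ⟨fun i _ j hj => h.ne _ j hj, fun i hi j hj => ?_⟩
        rcases Nat.eq_zero_or_pos i with rfl | hi0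
        · have := h.left j hj
          simp only [Nat.cast_zero, sub_zero]
          rw [this]
          have : 0 ≠ N - a := by omega
          tauto
        · rcases Nat.lt_or_ge i (N - a) with hi1 | hi1
          · have := h.far i hi0 (by omega) j hj
            rw [zero_sub]
            simp only [this, false_iff]
            omega
          · have hi2 : i = N - a := by omega
            have := h.right j hj
            rw [show (0 : ℤ) - i = a - N by omega, ← h.ring.per, sub_add_cancel, this]
            omega
      intro i j hij
      fin_cases i <;> fin_cases j <;> first | exact absurd hij (by decide) | skip
      · exact r01
      · exact r02
      · exact r12
    · intro i j hij
      fin_cases i <;> fin_cases j <;> first | exact absurd hij (by decide) | skip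
      all_goals simp
      all_goals omega
  · refine absurd (hmin.le_of_rung (by omega) (h.ring.strand 1 (a - 1) (by omega)) h.strand
      ⟨fun i _ j hj => h.ne _ j hj, fun i hi j hj => ?_⟩ ?_ ?_) ?_
    · rw [cast1]
      rcases Nat.lt_or_ge i (a - 1) with h3 | h3
      · constructor
        · intro hA
          rcases hcon _ (by omega) (by omega) j hj hA with h4 | ⟨h4, h5⟩
          · omega
          · rw [show 1 + i = a - 1 by omega, e2, h5] at hA
            exact absurd hA hR
        · rintro (⟨rfl, rfl⟩ | ⟨rfl, rfl⟩)
          · exact hL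
          · omega
      · rw [show 1 + i = a by omega, h.right j hj]
        omega
    · rw [Nat.even_iff]; omega
    · omega
    · omega
  · refine absurd (hmin.le_of_rung (by omega) (h.ring.strand 0 (a - 1) (by omega)) h.strand
      ⟨fun i _ j hj => h.ne _ j hj, fun i hi j hj => ?_⟩ ?_ ?_) ?_
    · rw [zero_add]
      rcases Nat.eq_zero_or_pos i with rfl | h3
      · rw [Nat.cast_zero, h.left j hj]
        omega
      · constructor
        · intro hA
          rcases hcon _ (by omega) (by omega) j hj hA with ⟨h4, h5⟩ | h4
          · rw [h4, h5] at hA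
            exact absurd hA hL
          · omega
        · rintro (⟨rfl, rfl⟩ | ⟨rfl, rfl⟩)
          · omega
          · rw [e2]; exact hR
    · rw [Nat.even_iff]; omega
    · omega
    · omega
  · refine hG.1.2.2.1 (hasLongTheta_of_links h.link_near h.link_far h.link_ear
      (fun i hi j hj => ⟨fun he => (h.apart_far_near j hj i hi).1 he.symm,
        fun hA => (h.apart_far_near j hj i hi).2 hA.symm⟩) (fun i hi j hj => ⟨h.ne _ j hj, ?_⟩)
      h.apart_far_ear (by omega) (by omega) (by omega))
    intro hA
    simp only [cast1] at hA
    rcases hcon _ (by omega) (by omega) j hj hA with ⟨h4, h5⟩ | ⟨h4, h5⟩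
    · rw [h4, h5] at hA
      exact hL hA
    · rw [show 1 + i = a - 1 by omega, e2, h5] at hA
      exact hR hA

end Ear

theorem Rung.exists_ring {s t : ℕ → V} {a b : ℕ} (hr : Rung G s a t b) (hs : Strand G s a)
    (ht : Strand G t b) (h4 : 4 ≤ a + b + 2) :
    ∃ δ : ℤ → V, Ring G δ (a + b + 2) ∧ (∀ i : ℕ, i ≤ a → δ i = s i) ∧
      (∀ j : ℕ, j ≤ b → δ (-(j + 1 : ℕ)) = t j) ∧
      ∀ z, (∃ i ≤ a, δ z = s i) ∨ ∃ j ≤ b, δ z = t j := by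
  refine ⟨_, (hs.holeFun ht h4 hr.ne hr.adj).ring, ?_, ?_, ?_⟩
  · intro i hi
    have : ((i : ℤ) % (a + b + 2 : ℕ)).toNat = i := by
      rw [Int.emod_eq_of_lt (by omega) (by omega)]
      simp
    simp only [this, hi, if_true]
  · intro j hj
    have : ((-(j + 1 : ℕ) : ℤ) % (a + b + 2 : ℕ)).toNat = a + 1 + (b - j) := by
      rw [← Int.add_emod_right, Int.emod_eq_of_lt (by omega) (by omega)]
      omega
    simp only [this]
    rw [if_neg (by omega)]
    congr 1
    omega
  · intro z
    have h1 := Int.emod_nonneg z (show ((a + b + 2 : ℕ) : ℤ) ≠ 0 by omega)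
    have h2 := Int.emod_lt_of_pos z (show (0 : ℤ) < (a + b + 2 : ℕ) by omega)
    by_cases h : (z % (a + b + 2 : ℕ)).toNat ≤ a
    · exact Or.inl ⟨_, h, if_pos h⟩
    · exact Or.inr ⟨_, by omega, if_neg h⟩

theorem Strand.cons {f : ℕ → V} {b : ℕ} (h : Strand G f b) {x : V} (hx : ∀ i ≤ b, f i ≠ x)
    (hax : ∀ i ≤ b, (G.Adj x (f i) ↔ i = 0)) :
    Strand G (fun i => if i = 0 then x else f (i - 1)) (b + 1) where
  inj i j hi hj he := by
    split_ifs at he with h1 h2 h3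
    · omega
    · exact absurd he.symm (hx _ (by omega))
    · exact absurd he (hx _ (by omega))
    · have := h.inj _ _ (by omega) (by omega) he
      omega
  adj i j hi hj := by
    split_ifs with h1 h2 h3
    · simp only [SimpleGraph.irrefl, false_iff]; omega
    · rw [hax _ (by omega)]; omega
    · rw [G.adj_comm, hax _ (by omega)]; omega
    · rw [h.adj _ _ (by omega) (by omega)]; omega

/-- An induced path `p 0, …, p k` with interior off the hole `c`, shorter than the arc
`c 0, …, c d` with the same ends, such that replacing this arc by the path gives a hole. -/
structure Detour (G : SimpleGraph V) (c : ℤ → V) (n : ℕ) (p : ℕ → V) (k d : ℕ) : Prop where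
  ring : Ring G c n
  strand : Strand G p k
  start : p 0 = c 0
  finish : p k = c d
  off : ∀ l, 0 < l → l < k → ∀ z, p l ≠ c z
  three_le : 3 ≤ k
  lt : k < d
  le : d + 3 ≤ n
  first : ∀ j, G.Adj (p 1) (c j) → c j = c 0 ∨ c j = c 1 ∨ c j = c 2
  last : ∀ j, G.Adj (p (k - 1)) (c j) → c j = c d ∨ c j = c (d - 1) ∨ c j = c (d - 2)
  far : ∀ i, 2 ≤ i → i + 2 ≤ k → ∀ y : ℕ, 1 ≤ y → y + d + 1 ≤ n → ¬ G.Adj (p i) (c (-y))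

namespace Detour

variable {c : ℤ → V} {n : ℕ} {p : ℕ → V} {k d : ℕ}

theorem adj_zero (h : Detour G c n p k d) {j : ℕ} (h1 : 1 ≤ j) (hj : j + 1 ≤ d) :
    G.Adj (p 0) (c j) ↔ j = 1 := by
  have := h.le
  rw [h.start, h.ring.adj _ _ (by omega) (by omega)]
  omega

theorem adj_end (h : Detour G c n p k d) {j : ℕ} (h1 : 1 ≤ j) (hj : j + 1 ≤ d) :
    G.Adj (p k) (c j) ↔ j + 1 = d := by
  have := h.le
  rw [h.finish, h.ring.adj _ _ (by omega) (by omega)]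
  omega

theorem adj_one (h : Detour G c n p k d) {j : ℕ} (h1 : 1 ≤ j) (hj : j + 1 ≤ d)
    (hA : G.Adj (p 1) (c j)) : j = 1 ∨ j = 2 := by
  have := h.le
  rcases h.first _ hA with he | he | he <;>
  · have := h.ring.inj _ _ (by omega) (by omega) he
    omega

theorem adj_pred (h : Detour G c n p k d) {j : ℕ} (h1 : 1 ≤ j) (hj : j + 1 ≤ d)
    (hA : G.Adj (p (k - 1)) (c j)) : j + 1 = d ∨ j + 2 = d := by
  have := h.le
  have := h.lt
  rcases h.last _ hA with he | he | he <;>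
  · have := h.ring.inj _ _ (by omega) (by omega) he
    omega

theorem strand_far (h : Detour G c n p k d) :
    Strand G (fun j : ℕ => c (-(j + 1 : ℕ))) (n - d - 2) := by
  have hle := h.le
  have e : (fun j : ℕ => c (-(j + 1 : ℕ))) = fun j : ℕ => c (-1 - j) := by
    funext j
    congr 1
    push_cast
    ring
  rw [e]
  exact h.ring.strand_neg (-1) _ (by omega)

theorem rung (h : Detour G c n p k d) :
    Rung G p k (fun j => c (-(j + 1 : ℕ))) (n - d - 2) := by
  have h3 := h.three_le
  have hlt := h.lt
  have hle := h.le
  refine ⟨fun i hi j hj he => ?_, fun i hi j hj => ?_⟩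
  · rcases Nat.eq_zero_or_pos i with rfl | hi0
    · rw [h.start] at he
      have := h.ring.inj _ _ (by omega) (by omega) he
      omega
    · rcases Nat.lt_or_ge i k with hik | hik
      · exact h.off i hi0 hik _ he
      · rw [show i = k by omega, h.finish] at he
        have := h.ring.inj _ _ (by omega) (by omega) he
        omega
  · by_cases hi0 : i = 0
    · rw [hi0, h.start, h.ring.adj _ _ (by omega) (by omega)]
      omega
    · by_cases hik : i = k
      · rw [hik, h.finish, h.ring.adj _ _ (by omega) (by omega)]
        omega
      · have : ¬ G.Adj (p i) (c (-(j + 1 : ℕ))) := by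
          intro hA
          by_cases hi1 : i = 1
          · rw [hi1] at hA
            rcases h.first _ hA with he | he | he <;>
            · have := h.ring.inj _ _ (by omega) (by omega) he
              omega
          · by_cases hik1 : i = k - 1
            · rw [hik1] at hA
              rcases h.last _ hA with he | he | he <;>
              · have := h.ring.inj _ _ (by omega) (by omega) he
                omega
            · exact h.far i (by omega) (by omega) _ (by omega) (by omega) hA
        simp only [this, false_iff]
        omega

theorem odd (h : Detour G c n p k d) (hn : Even n) (hmin : NoShorter G ℓ n) (hℓ : 4 ≤ ℓ)
    (hl : ℓ + d ≤ k + n) : Odd (k + d) := by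
  have h3 := h.three_le
  have hlt := h.lt
  have hle := h.le
  by_contra hcon
  rw [Nat.not_odd_iff_even, Nat.even_iff] at hcon
  rw [Nat.even_iff] at hn
  have := hmin.le_of_rung hℓ h.strand h.strand_far h.rung (by rw [Nat.even_iff]; omega) (by omega)
  omega

theorem exists_ear (h : Detour G c n p k d) {α β s s' : ℕ} (hαβ : α + 2 ≤ β) (hβk : β ≤ k)
    (hs : 1 ≤ s) (hss : s ≤ s') (hsd : s' + 1 ≤ d) (hodd : Odd (β - α + (s' - s)))
    (hα : ∀ j, s ≤ j → j ≤ s' → (G.Adj (p α) (c (j : ℕ)) ↔ j = s))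
    (hβ : ∀ j, s ≤ j → j ≤ s' → (G.Adj (p β) (c (j : ℕ)) ↔ j = s'))
    (hout : ∀ i ≤ k, i < α ∨ β < i → ∀ j, s ≤ j → j ≤ s' → ¬ G.Adj (p i) (c (j : ℕ))) :
    ∃ δ : ℤ → V, Ear G δ (k + n - d) (fun j => c (s + j : ℕ)) (β - α) (s' - s) ∧
      ∀ i : ℕ, α + i ≤ k → δ i = p (α + i) := by
  have h3 := h.three_le
  have hlt := h.lt
  have hle := h.le
  obtain ⟨δ, hδ, hp, hc, hz⟩ := h.rung.exists_ring h.strand h.strand_far (by omega)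
  rw [show k + (n - d - 2) + 2 = k + n - d by omega] at hδ
  have hpα : ∀ i : ℕ, α + i ≤ k → δ (i + α) = p (α + i) := by
    intro i hi
    rw [← hp _ hi]
    congr 1
    push_cast
    ring
  refine ⟨fun z => δ (z + α), ⟨hδ.shift α, ?_, by omega, by omega, ?_, ?_, ?_, ?_, hodd⟩, hpα⟩
  · have := h.ring.strand s (s' - s) (by omega)
    simpa using this
  · intro z j hj he
    rcases hz (z + α) with ⟨i, hi, hi'⟩ | ⟨i, hi, hi'⟩
    · rw [he] at hi'
      by_cases hi0 : i = 0
      · rw [hi0, h.start] at hi'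
        have := h.ring.inj _ _ (by omega) (by omega) hi'
        omega
      · by_cases hik : i = k
        · rw [hik, h.finish] at hi'
          have := h.ring.inj _ _ (by omega) (by omega) hi'
          omega
        · exact h.off i (by omega) (by omega) _ hi'.symm
    · rw [he] at hi'
      have := h.ring.inj _ _ (by omega) (by omega) hi'
      omega
  · intro y hy hy' j hj hA
    rcases Nat.lt_or_ge α y with h1 | h1
    · rcases Nat.lt_or_ge (y - α) (n - d) with h2 | h2
      · have := hc (y - α - 1) (by omega)
        rw [show (-((y - α - 1 + 1 : ℕ) : ℤ)) = -y + α by omega] at this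
        rw [this, h.ring.adj _ _ (by omega) (by omega)] at hA
        omega
      · have h4 : δ (-y + α) = p (k + n - d + α - y) := by
          rw [← hδ.per, ← hp _ (by omega)]
          congr 1
          omega
        rw [h4] at hA
        exact hout _ (by omega) (Or.inr (by omega)) _ (by omega) (by omega) hA
    · have := hp (α - y) (by omega)
      rw [show ((α - y : ℕ) : ℤ) = -y + α by omega] at this
      rw [this] at hA
      exact hout _ (by omega) (Or.inl (by omega)) _ (by omega) (by omega) hA
  · intro j hj
    have := hpα 0 (by omega)
    rw [Nat.cast_zero, add_zero] at this
    rw [this, hα _ (by omega) (by omega)]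
    omega
  · intro j hj
    have := hpα (β - α) (by omega)
    rw [show α + (β - α) = β by omega] at this
    rw [this, hβ _ (by omega) (by omega)]
    omega

theorem false_of_contacts (h : Detour G c n p k d) (hG : Candidate G ℓ) (hℓ : 6 ≤ ℓ)
    (hℓe : Even ℓ) (hmin : NoShorter G ℓ n) {α β s s' : ℕ} (hαβ : α + 2 ≤ β) (hβk : β ≤ k)
    (hs : 1 ≤ s) (hss : s ≤ s') (hsd : s' + 1 ≤ d) (hodd : Odd (β - α + (s' - s)))
    (hN : ℓ + d ≤ k + n) (hN' : ℓ + β + s + d ≤ k + n + s' + α + 2) (hn : β + s' + 1 < n + α + s)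
    (hα : ∀ j, s ≤ j → j ≤ s' → (G.Adj (p α) (c (j : ℕ)) ↔ j = s))
    (hβ : ∀ j, s ≤ j → j ≤ s' → (G.Adj (p β) (c (j : ℕ)) ↔ j = s'))
    (hout : ∀ i ≤ k, i < α ∨ β < i → ∀ j, s ≤ j → j ≤ s' → ¬ G.Adj (p i) (c (j : ℕ)))
    (hin : ∀ i, α < i → i < β → ∀ j, s ≤ j → j ≤ s' → G.Adj (p i) (c (j : ℕ)) →
      (i = α + 1 ∧ j = s) ∨ (i + 1 = β ∧ j = s')) : False := by
  obtain ⟨δ, hE, hp⟩ := h.exists_ear hαβ hβk hs hss hsd hodd hα hβ hout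
  have hle := h.le
  refine hE.false_of_contacts hG hℓ hℓe hmin (by omega) (by omega) (by omega) ?_
  intro i hi hi' j hj hA
  rw [hp i (by omega)] at hA
  have := hin _ (by omega) (by omega) _ (by omega) (by omega) hA
  omega

theorem false_of_ladder (h : Detour G c n p k d) (hG : Candidate G ℓ) (hℓ : 6 ≤ ℓ)
    (hℓe : Even ℓ) (hmin : NoShorter G ℓ n) (hd : d = k + 1) (hk : 2 * k < n) (hln : ℓ < n)
    (hmid : ∀ i, 2 ≤ i → i + 2 ≤ k → ∀ j : ℤ, G.Adj (p i) (c j) → c j = c i ∨ c j = c (i + 1)) :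
    False := by
  classical
  have h3 := h.three_le
  have hle := h.le
  have hK : ∀ i ≤ k, ∀ j : ℕ, 1 ≤ j → j ≤ k → G.Adj (p i) (c j) → j = i ∨ j = i + 1 := by
    intro i hi j hj hj' hA
    by_cases h0 : i = 0
    · rw [h0, h.adj_zero hj (by omega)] at hA
      omega
    by_cases h1 : i = 1
    · rw [h1] at hA
      have := h.adj_one hj (by omega) hA
      omega
    by_cases h2 : i = k
    · rw [h2, h.adj_end hj (by omega)] at hA
      omega
    by_cases h4 : i = k - 1
    · rw [h4] at hA
      have := h.adj_pred hj (by omega) hA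
      omega
    rcases hmid i (by omega) (by omega) _ hA with he | he <;>
    · have := h.ring.inj _ _ (by omega) (by omega) he
      omega
  have hex : ∃ g, 2 ≤ g ∧ ∃ j, j + g ≤ k ∧ G.Adj (p j) (c (j + 1 : ℕ)) ∧
      G.Adj (p (j + g)) (c (j + g : ℕ)) := by
    refine ⟨k, by omega, 0, by omega, ?_, ?_⟩
    · rw [h.adj_zero (by omega) (by omega)]
    · rw [zero_add, h.adj_end (by omega) (by omega)]
      omega
  obtain ⟨hg2, α, hgk, hU, hL⟩ := Nat.find_spec hex
  have hmin' := fun g' (hg' : g' < Nat.find hex) => Nat.find_min hex hg'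
  generalize Nat.find hex = g at *
  refine h.false_of_contacts hG hℓ hℓe hmin (α := α) (β := α + g) (s := α + 1) (s' := α + g)
    (by omega) (by omega) (by omega) (by omega) (by omega) ?_ (by omega) (by omega) (by omega)
    ?_ ?_ ?_ ?_
  · rw [Nat.odd_iff]; omega
  · intro j hj hj'
    constructor
    · intro hA
      have := hK _ (by omega) _ (by omega) (by omega) hA
      omega
    · rintro rfl
      exact hU
  · intro j hj hj'
    constructor
    · intro hA
      have := hK _ (by omega) _ (by omega) (by omega) hA
      omega
    · rintro rfl
      exact hL
  · intro i hi hi' j hj hj' hA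
    have := hK _ (by omega) _ (by omega) (by omega) hA
    omega
  · intro i hi hi' j hj hj' hA
    rcases hK _ (by omega) _ (by omega) (by omega) hA with rfl | rfl
    · by_contra hcon
      refine hmin' (j - α) (by omega) ⟨by omega, α, by omega, hU, ?_⟩
      rwa [show α + (j - α) = j by omega]
    · by_contra hcon
      refine hmin' (α + g - i) (by omega) ⟨by omega, i, by omega, hA, ?_⟩
      rwa [show i + (α + g - i) = α + g by omega]

theorem hasLongBanTheBomb (h : Detour G c n p 3 d) (hd : ℓ + 1 ≤ d) (hℓ : 6 ≤ ℓ)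
    (hn : ℓ + d ≤ n + 3) (h1 : G.Adj (p 1) (c 2)) (h2 : G.Adj (p 2) (c (d - 2))) :
    HasLongBanTheBomb G ℓ := by
  have hle := h.le
  have hR := h.ring
  have e1 : G.Adj (p 1) (p 2) := by rw [h.strand.adj _ _ (by omega) (by omega)]; omega
  have e2 : G.Adj (p 1) (c 0) := by
    rw [← h.start, h.strand.adj _ _ (by omega) (by omega)]; omega
  have e3 : G.Adj (p 2) (c d) := by
    rw [← h.finish, h.strand.adj _ _ (by omega) (by omega)]; omega
  have n1 : ∀ z : ℤ, 3 ≤ z → z < n → ¬ G.Adj (p 1) (c z) := by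
    intro z hz hz' hA
    rcases h.first _ hA with he | he | he <;>
    · have := hR.inj _ _ (by omega) (by omega) he
      omega
  have n2 : ∀ z : ℤ, d - n < z → z ≤ d - 3 → ¬ G.Adj (p 2) (c z) := by
    intro z hz hz' hA
    rcases h.last _ hA with he | he | he <;>
    · have := hR.inj _ _ (by omega) (by omega) he
      omega
  have n2' : ∀ z : ℤ, d < z → z ≤ n → ¬ G.Adj (p 2) (c z) := by
    intro z hz hz' hA
    rcases h.last _ hA with he | he | he <;>
    · have := hR.inj _ _ (by omega) (by omega) he
      omega
  have sP : Strand G (fun i => if i = 0 then p 2 else (fun i : ℕ => c (d + i)) (i - 1))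
      (n - d + 1) := by
    refine (hR.strand d (n - d) (by omega)).cons (fun i _ he => h.off 2 (by omega) (by omega) _
      he.symm) (fun i hi => ?_)
    rcases Nat.eq_zero_or_pos i with rfl | hi0
    · simpa using e3
    · simp only [n2' (d + i) (by omega) (by omega), false_iff]
      omega
  have sQ : Strand G (fun i => if i = 0 then p 2 else (fun i : ℕ => c ((d - 2 : ℤ) - i)) (i - 1))
      (d - 4 + 1) := by
    refine (hR.strand_neg (d - 2) (d - 4) (by omega)).cons (fun i _ he => h.off 2 (by omega)
      (by omega) _ he.symm) (fun i hi => ?_)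
    rcases Nat.eq_zero_or_pos i with rfl | hi0
    · simpa using h2
    · simp only [n2 (d - 2 - i) (by omega) (by omega), false_iff]
      omega
  refine hasLongBanTheBomb_of_strands (u := p 1) (w := c 1) sP sQ rfl (by omega) (by omega)
    (h.off 1 (by omega) (by omega) _) ?_ ?_ ?_ ?_ ?_ ?_ ?_ ?_ ?_ (by omega) (by omega)
  · intro i hi
    dsimp only
    split_ifs with h0
    · exact e1.ne'
    · exact fun he => h.off 1 (by omega) (by omega) _ he.symm
  · intro i hi
    dsimp only
    split_ifs with h0
    · exact h.off 2 (by omega) (by omega) _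
    · intro he
      have := hR.inj _ _ (by omega) (by omega) he
      omega
  · intro i hi
    dsimp only
    split_ifs with h0
    · exact e1.ne'
    · exact fun he => h.off 1 (by omega) (by omega) _ he.symm
  · intro i hi
    dsimp only
    split_ifs with h0
    · exact h.off 2 (by omega) (by omega) _
    · intro he
      have := hR.inj _ _ (by omega) (by omega) he
      omega
  · intro i hi
    dsimp only
    split_ifs with h0
    · simp [e1, h0]
    · by_cases hi' : i = n - d + 1
      · rw [show (d : ℤ) + (i - 1 : ℕ) = 0 + n by omega, hR.per]
        simp [e2, hi']
      · simp only [n1 (d + (i - 1 : ℕ)) (by omega) (by omega), false_iff]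
        omega
  · intro i hi
    dsimp only
    split_ifs with h0
    · have := n2 1 (by omega) (by omega)
      rw [G.adj_comm] at this
      simp only [this, false_iff]
      omega
    · rw [hR.adj _ _ (by omega) (by omega)]
      omega
  · intro i hi
    dsimp only
    split_ifs with h0
    · simp [e1, h0]
    · by_cases hi' : i = d - 4 + 1
      · rw [show (d : ℤ) - 2 - (i - 1 : ℕ) = 2 by omega]
        simp [h1, hi']
      · simp only [n1 (d - 2 - (i - 1 : ℕ)) (by omega) (by omega), false_iff]
        omega
  · intro i hi
    dsimp only
    split_ifs with h0
    · have := n2 1 (by omega) (by omega)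
      rw [G.adj_comm] at this
      simp only [this, false_iff]
      omega
    · rw [hR.adj _ _ (by omega) (by omega)]
      omega
  · intro i hi j hj hi0 hj0
    simp only [hi0, hj0, if_false]
    constructor
    · intro he
      have := hR.inj _ _ (by omega) (by omega) he
      omega
    · rw [hR.adj _ _ (by omega) (by omega)]
      omega

theorem false_of_sparse (h : Detour G c n p k d) (hG : Candidate G ℓ) (hℓ : 6 ≤ ℓ)
    (hℓe : Even ℓ) (hmin : NoShorter G ℓ n) {m : ℕ} (hm : n = 2 * m) (hlm : ℓ + 1 ≤ m)
    (hkm : k + 2 ≤ m) (hdm : d ≤ m + 4)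
    (hd : m + 2 < d → G.Adj (p 1) (c 2) ∨ G.Adj (p (k - 1)) (c (d - 2)))
    (hmid : ∀ i, 2 ≤ i → i + 2 ≤ k → ∀ j : ℤ, ¬ G.Adj (p i) (c j)) : False := by
  classical
  have h3 := h.three_le
  have hlt := h.lt
  have hle := h.le
  have hodd := h.odd (by rw [hm]; exact even_two_mul m) hmin (by omega) (by omega)
  rw [Nat.odd_iff] at hodd
  have hℓe' := Nat.even_iff.1 hℓe
  obtain ⟨α, hα⟩ : ∃ α, α = if G.Adj (p 1) (c 2) then 1 else 0 := ⟨_, rfl⟩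
  obtain ⟨β, hβ⟩ : ∃ β, β = if G.Adj (p (k - 1)) (c (d - 2)) then 1 else 0 := ⟨_, rfl⟩
  have a1 : (α = 1 ∧ G.Adj (p 1) (c 2)) ∨ (α = 0 ∧ ¬ G.Adj (p 1) (c 2)) := by
    split_ifs at hα with hA
    · exact Or.inl ⟨hα, hA⟩
    · exact Or.inr ⟨hα, hA⟩
  have b1 : (β = 1 ∧ G.Adj (p (k - 1)) (c (d - 2))) ∨
      (β = 0 ∧ ¬ G.Adj (p (k - 1)) (c (d - 2))) := by
    split_ifs at hβ with hA
    · exact Or.inl ⟨hβ, hA⟩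
    · exact Or.inr ⟨hβ, hA⟩
  clear hα hβ
  have h01 : α ≤ 1 ∧ β ≤ 1 := by omega
  have hdαβ : m + 2 < d → 1 ≤ α + β := by
    intro hlt
    rcases hd hlt with hA | hA
    · rcases a1 with ⟨rfl, -⟩ | ⟨-, hA'⟩
      · omega
      · exact absurd hA hA'
    · rcases b1 with ⟨rfl, -⟩ | ⟨-, hA'⟩
      · omega
      · exact absurd hA hA'
  have K1 : ∀ j : ℕ, α + 1 ≤ j → j + 1 ≤ d → G.Adj (p 1) (c j) → j = α + 1 := by
    intro j hj hj' hA
    rcases h.adj_one (by omega) hj' hA with rfl | rfl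
    · omega
    · rcases a1 with ⟨h1, -⟩ | ⟨-, h1⟩
      · omega
      · exact absurd hA h1
  have Kk : ∀ j : ℕ, 1 ≤ j → j + 1 + β ≤ d → G.Adj (p (k - 1)) (c j) → j + 1 + β = d := by
    intro j hj hj' hA
    rcases h.adj_pred hj (by omega) hA with h4 | h4
    · omega
    · rcases b1 with ⟨h1, -⟩ | ⟨-, h1⟩
      · omega
      · rw [show (j : ℤ) = d - 2 by omega] at hA
        exact absurd hA h1
  by_cases hk : k = 3 ∧ α = 1 ∧ β = 1
  · obtain ⟨rfl, rfl, rfl⟩ := hk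
    rcases Nat.lt_or_ge ℓ d with h4 | h4
    · refine hG.1.2.2.2 (h.hasLongBanTheBomb (by omega) hℓ (by omega) ?_ ?_)
      · simpa using a1
      · simpa using b1
    · obtain ⟨δ, hE, -⟩ := h.exists_ear (α := 0) (β := 3) (s := 1) (s' := d - 1) (by omega)
        (by omega) (by omega) (by omega) (by omega) (by rw [Nat.odd_iff]; omega)
        (fun j hj hj' => h.adj_zero (by omega) (by omega))
        (fun j hj hj' => by rw [h.adj_end (by omega) (by omega)]; omega)
        (fun i hi hi' => by omega)
      exact hE.false_of_short hG (by omega) (by omega) (by omega) (by omega)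
  refine h.false_of_contacts hG hℓ hℓe hmin (α := α) (β := k - β) (s := α + 1) (s' := d - 1 - β)
    (by omega) (by omega) (by omega) (by omega) (by omega) (by rw [Nat.odd_iff]; omega)
    (by omega) (by omega) (by omega) ?_ ?_ ?_ ?_
  · intro j hj hj'
    rcases a1 with ⟨h1, hA⟩ | ⟨h1, -⟩
    · rw [h1]
      refine ⟨fun hA' => ?_, fun hj => by rw [hj]; exact hA⟩
      have := K1 j hj (by omega) hA'
      omega
    · rw [h1, h.adj_zero (by omega) (by omega)]
  · intro j hj hj'
    rcases b1 with ⟨h1, hA⟩ | ⟨h1, -⟩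
    · rw [h1]
      refine ⟨fun hA' => ?_, fun hj => ?_⟩
      · have := Kk j (by omega) (by omega) hA'
        omega
      · rw [hj, show ((d - 1 - 1 : ℕ) : ℤ) = d - 2 by omega]
        exact hA
    · rw [h1, Nat.sub_zero, h.adj_end (by omega) (by omega)]
      omega
  · intro i hi hi' j hj hj' hA
    rcases hi' with h4 | h4
    · rw [show i = 0 by omega, h.adj_zero (by omega) (by omega)] at hA
      omega
    · rw [show i = k by omega, h.adj_end (by omega) (by omega)] at hA
      omega
  · intro i hi hi' j hj hj' hA
    by_cases h4 : i = 1
    · rw [h4] at hA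
      have := K1 j hj (by omega) hA
      omega
    by_cases h5 : i = k - 1
    · rw [h5] at hA
      have := Kk j (by omega) (by omega) hA
      omega
    exact absurd hA (hmid i (by omega) (by omega) _)

end Detour

theorem false_of_chord {c : ℤ → V} {n : ℕ} {p : ℕ → V} {k i j : ℕ} (hR : Ring G c n)
    (hp : Strand G p k) (hoff : ∀ l, 0 < l → l < k → ∀ z, p l ≠ c z) (hn : n = 2 * k + 4)
    (hmin : NoShorter G ℓ n) (hℓ : 4 ≤ ℓ) (hln : 2 * ℓ < n) (hi : 2 ≤ i) (hij : i ≤ j)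
    (hj : j + 2 ≤ k) (hU : G.Adj (p i) (c (i + 1))) (hL : G.Adj (p j) (c (-(j + 1))))
    (hcon : ∀ l, i ≤ l → l ≤ j → ∀ z, G.Adj (p l) (c z) →
      (l = i ∧ c z = c (i + 1)) ∨ (l = j ∧ c z = c (-(j + 1)))) : False := by
  have hs := hp.shift i (j - i) (by omega)
  have h1 := hmin.le_of_rung hℓ hs (hR.strand_neg (i + 1) (i + j + 2) (by omega))
    ⟨fun l hl y hy => hoff _ (by omega) (by omega) _, fun l hl y hy => ⟨fun hA => ?_, ?_⟩⟩
    (by rw [Nat.even_iff]; omega)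
  rotate_left
  · rcases hcon _ (by omega) (by omega) _ hA with ⟨h, he⟩ | ⟨h, he⟩ <;>
    · have := hR.inj _ _ (by omega) (by omega) he
      omega
  · rintro (⟨rfl, rfl⟩ | ⟨rfl, rfl⟩)
    · simpa using hU
    · rw [show i + (j - i) = j by omega,
        show (i + 1 - (i + j + 2 : ℕ) : ℤ) = -(j + 1) by push_cast; ring]
      exact hL
  have h2 := hmin.le_of_rung hℓ hs (hR.strand (i + 1) (n - (i + j + 2)) (by omega))
    ⟨fun l hl y hy => hoff _ (by omega) (by omega) _, fun l hl y hy => ⟨fun hA => ?_, ?_⟩⟩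
    (by rw [Nat.even_iff]; omega)
  rotate_left
  · rcases hcon _ (by omega) (by omega) _ hA with ⟨h, he⟩ | ⟨h, he⟩
    · have := hR.inj _ _ (by omega) (by omega) he
      omega
    · rw [← hR.per (-(j + 1))] at he
      have := hR.inj _ _ (by omega) (by omega) he
      omega
  · rintro (⟨rfl, rfl⟩ | ⟨rfl, rfl⟩)
    · simpa using hU
    · rw [show i + (j - i) = j by omega,
        show (i + 1 + (n - (i + j + 2) : ℕ) : ℤ) = -(j + 1) + n by omega, hR.per]
      exact hL
  omega

theorem false_of_two_sided {c : ℤ → V} {n : ℕ} {p : ℕ → V} {k : ℕ} (hR : Ring G c n)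
    (hp : Strand G p k) (hoff : ∀ l, 0 < l → l < k → ∀ z, p l ≠ c z) (hn : n = 2 * k + 4)
    (hmin : NoShorter G ℓ n) (hℓ : 4 ≤ ℓ) (hln : 2 * ℓ < n)
    (hmid : ∀ i, 2 ≤ i → i + 2 ≤ k → ∀ z, G.Adj (p i) (c z) →
      c z = c (i + 1) ∨ c z = c (-(i + 1)))
    (hU : ∃ i, 2 ≤ i ∧ i + 2 ≤ k ∧ G.Adj (p i) (c (i + 1)))
    (hL : ∃ j, 2 ≤ j ∧ j + 2 ≤ k ∧ G.Adj (p j) (c (-(j + 1)))) : False := by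
  classical
  have hex : ∃ g, ∃ i j, 2 ≤ i ∧ i + 2 ≤ k ∧ G.Adj (p i) (c (i + 1)) ∧
      2 ≤ j ∧ j + 2 ≤ k ∧ G.Adj (p j) (c (-(j + 1))) ∧ (j = i + g ∨ i = j + g) := by
    obtain ⟨i, hi, hi', hA⟩ := hU
    obtain ⟨j, hj, hj', hB⟩ := hL
    rcases Nat.le_total i j with h | h
    · exact ⟨j - i, i, j, hi, hi', hA, hj, hj', hB, by omega⟩
    · exact ⟨i - j, i, j, hi, hi', hA, hj, hj', hB, by omega⟩
  obtain ⟨i, j, hi, hi', hA, hj, hj', hB, hij⟩ := Nat.find_spec hex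
  have hmin' := fun g' (hg' : g' < Nat.find hex) => Nat.find_min hex hg'
  generalize Nat.find hex = g at *
  have hplus : ∀ l, 2 ≤ l → l + 2 ≤ k → G.Adj (p l) (c (l + 1)) → g + j ≤ l ∨ g + l ≤ j := by
    intro l hl hl' hC
    by_contra hcon
    rcases Nat.le_total l j with h | h
    · exact hmin' (j - l) (by omega) ⟨l, j, hl, hl', hC, hj, hj', hB, by omega⟩
    · exact hmin' (l - j) (by omega) ⟨l, j, hl, hl', hC, hj, hj', hB, by omega⟩
  have hminus : ∀ l, 2 ≤ l → l + 2 ≤ k → G.Adj (p l) (c (-(l + 1))) →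
      g + i ≤ l ∨ g + l ≤ i := by
    intro l hl hl' hC
    by_contra hcon
    rcases Nat.le_total l i with h | h
    · exact hmin' (i - l) (by omega) ⟨i, l, hi, hi', hA, hl, hl', hC, by omega⟩
    · exact hmin' (l - i) (by omega) ⟨i, l, hi, hi', hA, hl, hl', hC, by omega⟩
  have hadj : ∀ {l : ℕ} {z w : ℤ}, c z = c w → G.Adj (p l) (c z) → G.Adj (p l) (c w) := by
    intro l z w he hC
    rwa [← he]
  rcases hij with hij | hij
  · refine false_of_chord hR hp hoff hn hmin hℓ hln hi (by omega) hj' hA hB ?_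
    intro l hl hl' z hz
    rcases hmid l (by omega) (by omega) z hz with he | he
    · have := hplus l (by omega) (by omega) (hadj he hz)
      have hli : l = i := by omega
      subst hli
      exact Or.inl ⟨rfl, he⟩
    · have := hminus l (by omega) (by omega) (hadj he hz)
      have hlj : l = j := by omega
      subst hlj
      exact Or.inr ⟨rfl, he⟩
  · refine false_of_chord hR.reflect hp (fun l h h' z => hoff l h h' _) hn hmin hℓ hln hj
      (i := j) (j := i) (by omega) hi' hB (by rw [neg_neg]; exact hA) ?_
    intro l hl hl' z hz
    rcases hmid l (by omega) (by omega) _ hz with he | he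
    · have := hplus l (by omega) (by omega) (hadj he hz)
      have hli : l = i := by omega
      subst hli
      exact Or.inr ⟨rfl, by rw [he, neg_neg]⟩
    · have := hminus l (by omega) (by omega) (hadj he hz)
      have hlj : l = j := by omega
      subst hlj
      exact Or.inl ⟨rfl, he⟩

/-- There is a walk of length at most `k` from `x` to `y`. -/
def Reach (G : SimpleGraph V) (x y : V) (k : ℕ) : Prop :=
  ∃ W : G.Walk x y, W.length ≤ k

theorem Reach.of_adj {x y : V} (h : G.Adj x y) : Reach G x y 1 :=
  ⟨Walk.cons h Walk.nil, by simp⟩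

theorem Reach.trans {x y z : V} {a b : ℕ} (h : Reach G x y a) (h' : Reach G y z b) :
    Reach G x z (a + b) := by
  obtain ⟨W, hW⟩ := h
  obtain ⟨W', hW'⟩ := h'
  exact ⟨W.append W', by rw [Walk.length_append]; omega⟩

theorem Reach.of_forall_adj {p : ℕ → V} {k : ℕ} (h : ∀ l < k, G.Adj (p l) (p (l + 1)))
    (a b : ℕ) (hab : a ≤ b) (hb : b ≤ k) : Reach G (p a) (p b) (b - a) := by
  obtain ⟨W, hW, -⟩ := exists_walk_of_adj (G := G) (b - a) (fun i => p (a + i))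
    (fun i hi => h (a + i) (by omega))
  refine ⟨W.copy rfl (by rw [show a + (b - a) = b by omega]), by simp [hW]⟩

/-- The vertex `c j` is at distance at most `r` from `c i` along the cyclic sequence `c`. -/
def Near (c : ℤ → V) (i j : ℤ) (r : ℕ) : Prop :=
  ∃ t : ℤ, -r ≤ t ∧ t ≤ r ∧ c j = c (i + t)

theorem Near.mono {c : ℤ → V} {i j : ℤ} {r s : ℕ} (h : Near c i j r) (hrs : r ≤ s) :
    Near c i j s := by
  obtain ⟨t, h1, h2, h3⟩ := h
  exact ⟨t, by omega, by omega, h3⟩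

theorem Near.trans {c : ℤ → V} {n : ℕ} (hR : Ring G c n) {i j l : ℤ} {r s : ℕ}
    (h : Near c i j r) (h' : Near c j l s) : Near c i l (r + s) := by
  obtain ⟨t, h1, h2, h3⟩ := h
  obtain ⟨t', h1', h2', h3'⟩ := h'
  refine ⟨t + t', by omega, by omega, ?_⟩
  rw [h3', hR.add_of_eq h3]
  congr 1
  ring

/-- The neighbours on the cyclic sequence `c` of any vertex off `c` lie in three
consecutive places. -/
def CleanSeq (G : SimpleGraph V) (c : ℤ → V) : Prop :=
  ∀ z, (∀ j, z ≠ c j) → ∃ e : ℤ, ∀ j, G.Adj z (c j) →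
    c j = c (e - 1) ∨ c j = c e ∨ c j = c (e + 1)

theorem CleanSeq.reflect {c : ℤ → V} (h : CleanSeq G c) : CleanSeq G (fun i => c (-i)) := by
  intro z hz
  obtain ⟨e, he⟩ := h z (fun j => by simpa using hz (-j))
  refine ⟨-e, fun j hj => ?_⟩
  have := he _ hj
  beta_reduce
  rw [show -(-e - 1) = e + 1 by ring, show -(-e + 1) = e - 1 by ring, neg_neg]
  tauto

theorem CleanSeq.shift {c : ℤ → V} (h : CleanSeq G c) (x : ℤ) :
    CleanSeq G (fun i => c (i + x)) := by
  intro z hz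
  obtain ⟨e, he⟩ := h z (fun j => by simpa using hz (j - x))
  refine ⟨e - x, fun j hj => ?_⟩
  have := he _ hj
  beta_reduce
  rw [show e - x - 1 + x = e - 1 by ring, show e - x + 1 + x = e + 1 by ring, sub_add_cancel]
  exact this

theorem CleanSeq.exists_hull {c : ℤ → V} {n : ℕ} (h : CleanSeq G c) (hR : Ring G c n) {z : V}
    (hz : ∀ j, z ≠ c j) {i : ℤ} (hi : G.Adj z (c i)) :
    ∃ a, i - 2 ≤ a ∧ a ≤ i ∧ G.Adj z (c a) ∧
      ∀ j, G.Adj z (c j) → c j = c a ∨ c j = c (a + 1) ∨ c j = c (a + 2) := by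
  obtain ⟨e, he⟩ := h z hz
  obtain ⟨A, hA1, hA2, hA⟩ : ∃ A, i - 2 ≤ A ∧ A ≤ i ∧
      ∀ j, G.Adj z (c j) → c j = c A ∨ c j = c (A + 1) ∨ c j = c (A + 2) := by
    have key : ∀ x : ℤ, -1 ≤ x → x ≤ 1 → c i = c (e + x) → ∃ A, i - 2 ≤ A ∧ A ≤ i ∧
        ∀ j, G.Adj z (c j) → c j = c A ∨ c j = c (A + 1) ∨ c j = c (A + 2) := by
      intro x hx1 hx2 hx
      refine ⟨i - x - 1, by omega, by omega, fun j hj => ?_⟩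
      have e1 := hR.add_of_eq hx (-x - 1)
      have e2 := hR.add_of_eq hx (-x)
      have e3 := hR.add_of_eq hx (-x + 1)
      rw [show e + x + (-x - 1) = e - 1 by ring, show i + (-x - 1) = i - x - 1 by ring] at e1
      rw [show e + x + (-x) = e by ring, show i + -x = i - x - 1 + 1 by ring] at e2
      rw [show e + x + (-x + 1) = e + 1 by ring, show i + (-x + 1) = i - x - 1 + 2 by ring] at e3
      rw [e1, e2, e3]
      exact he j hj
    rcases he i hi with h1 | h1 | h1
    · exact key (-1) (by omega) (by omega) (by rw [h1]; rfl)
    · exact key 0 (by omega) (by omega) (by rw [h1, add_zero])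
    · exact key 1 (by omega) (by omega) h1
  have hne : ∀ {x j : ℤ}, ¬ G.Adj z (c x) → G.Adj z (c j) → c j ≠ c x := by
    intro x j hx hj he
    exact hx (by rwa [← he])
  by_cases h0 : G.Adj z (c A)
  · exact ⟨A, hA1, hA2, h0, hA⟩
  have hAi : A ≠ i := fun h => h0 (by rwa [h])
  by_cases h1 : G.Adj z (c (A + 1))
  · refine ⟨A + 1, by omega, by omega, h1, fun j hj => ?_⟩
    have := hne h0 hj
    have := hA j hj
    rw [show A + 1 + 1 = A + 2 by ring]
    tauto
  · have hAi' : A + 1 ≠ i := fun h => h1 (by rwa [h])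
    refine ⟨i, by omega, le_rfl, hi, fun j hj => ?_⟩
    have := hne h0 hj
    have := hne h1 hj
    have := hA j hj
    rw [show i = A + 2 by omega]
    tauto

theorem CleanSeq.exists_hull_right {c : ℤ → V} {n : ℕ} (h : CleanSeq G c) (hR : Ring G c n)
    {z : V} (hz : ∀ j, z ≠ c j) {i : ℤ} (hi : G.Adj z (c i)) :
    ∃ b, i ≤ b ∧ b ≤ i + 2 ∧ G.Adj z (c b) ∧
      ∀ j, G.Adj z (c j) → c j = c b ∨ c j = c (b - 1) ∨ c j = c (b - 2) := by
  obtain ⟨a, h1, h2, h3, h4⟩ := h.reflect.exists_hull hR.reflect (fun j => hz (-j)) (i := -i)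
    (by rwa [neg_neg])
  refine ⟨-a, by omega, by omega, h3, fun j hj => ?_⟩
  have := h4 (-j) (by rwa [neg_neg])
  rwa [neg_neg, show -(a + 1) = -a - 1 by ring, show -(a + 2) = -a - 2 by ring] at this

theorem Strand.replace_ends {f : ℕ → V} {k : ℕ} (h : Strand G f k) (hk : 2 ≤ k) {x y : V}
    (hxy : x ≠ y) (hna : ¬ G.Adj x y) (hx : ∀ i, 0 < i → i < k → f i ≠ x)
    (hy : ∀ i, 0 < i → i < k → f i ≠ y) (hax : ∀ i, 0 < i → i < k → (G.Adj x (f i) ↔ i = 1))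
    (hay : ∀ i, 0 < i → i < k → (G.Adj y (f i) ↔ i + 1 = k)) :
    Strand G (fun l => if l = 0 then x else if l < k then f l else y) k := by
  have := (h.shift 1 (k - 2) (by omega)).cap hxy hna (fun i hi => hx _ (by omega) (by omega))
    (fun i hi => hy _ (by omega) (by omega))
    (fun i hi => by rw [hax _ (by omega) (by omega)]; omega)
    (fun i hi => by rw [hay _ (by omega) (by omega)]; omega)
  rw [show k - 2 + 2 = k by omega] at this
  convert this using 2 with l
  by_cases h0 : l = 0
  · simp [h0]
  · simp only [h0, if_false, show l ≤ k - 2 + 1 ↔ l < k by omega, show 1 + (l - 1) = l by omega]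

/-- An induced path leaving a clean hole `c` at `c 0`, with interior off `c`, such that
walks with fewer than `k` edges between vertices of `c` do not shorten distances along `c`. -/
structure Shortcut (G : SimpleGraph V) (c : ℤ → V) (n : ℕ) (p : ℕ → V) (k : ℕ) : Prop where
  ring : Ring G c n
  strand : Strand G p k
  start : p 0 = c 0
  off : ∀ l, 0 < l → l < k → ∀ z, p l ≠ c z
  three_le : 3 ≤ k
  le : 2 * k + 4 ≤ n
  clean : CleanSeq G c
  near : ∀ i j : ℤ, ∀ r < k, Reach G (c i) (c j) r → Near c i j r

namespace Shortcut

variable {c : ℤ → V} {n : ℕ} {p : ℕ → V} {k : ℕ}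

theorem reflect (h : Shortcut G c n p k) : Shortcut G (fun i => c (-i)) n p k where
  ring := h.ring.reflect
  strand := h.strand
  start := by simpa using h.start
  off l h0 h1 z := h.off l h0 h1 _
  three_le := h.three_le
  le := h.le
  clean := h.clean.reflect
  near i j r hr hij := by
    obtain ⟨t, h1, h2, h3⟩ := h.near _ _ r hr hij
    refine ⟨-t, by omega, by omega, ?_⟩
    beta_reduce
    rw [h3]
    congr 1
    ring

theorem reach (h : Shortcut G c n p k) (a b : ℕ) (hab : a ≤ b) (hb : b ≤ k) :
    Reach G (p a) (p b) (b - a) :=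
  Reach.of_forall_adj (p := p) (k := k)
    (fun l hl => (h.strand.adj _ _ (by omega) (by omega)).2 (Or.inl rfl)) a b hab hb

theorem near_left (h : Shortcut G c n p k) {a z : ℤ} {i : ℕ} (hi : 2 ≤ i) (hi' : i + 2 ≤ k)
    (ha : G.Adj (p 1) (c a)) (hz : G.Adj (p i) (c z)) : Near c a z (i + 1) := by
  refine h.near _ _ _ (by omega) ?_
  have := ((Reach.of_adj ha.symm).trans (h.reach 1 i (by omega) (by omega))).trans
    (Reach.of_adj hz)
  rwa [show 1 + (i - 1) + 1 = i + 1 by omega] at this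

theorem near_right (h : Shortcut G c n p k) {b z : ℤ} {i : ℕ} (hi : 2 ≤ i) (hi' : i + 2 ≤ k)
    (hb : G.Adj (p (k - 1)) (c b)) (hz : G.Adj (p i) (c z)) : Near c z b (k - i + 1) := by
  refine h.near _ _ _ (by omega) ?_
  have := ((Reach.of_adj hz.symm).trans (h.reach i (k - 1) (by omega) (by omega))).trans
    (Reach.of_adj hb)
  rwa [show 1 + (k - 1 - i) + 1 = k - i + 1 by omega] at this

theorem adj_first (h : Shortcut G c n p k) : G.Adj (p 1) (c 0) := by
  have := h.three_le
  rw [← h.start, h.strand.adj _ _ (by omega) (by omega)]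
  omega

theorem adj_last (h : Shortcut G c n p k) {d : ℤ} (hd : p k = c d) :
    G.Adj (p (k - 1)) (c d) := by
  have := h.three_le
  rw [← hd, h.strand.adj _ _ (by omega) (by omega)]
  omega

theorem exists_detour (h : Shortcut G c n p k) {a : ℤ} {d : ℕ} (hd : k < d) (hd' : d + 3 ≤ n)
    (ha : G.Adj (p 1) (c a)) (hb : G.Adj (p (k - 1)) (c (d + a)))
    (ha' : ∀ j, G.Adj (p 1) (c j) → c j = c a ∨ c j = c (a + 1) ∨ c j = c (a + 2))
    (hb' : ∀ j, G.Adj (p (k - 1)) (c j) →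
      c j = c (d + a) ∨ c j = c (d + a - 1) ∨ c j = c (d + a - 2))
    (hna : ∀ i, 2 ≤ i → i + 2 ≤ k → ¬ G.Adj (p i) (c a))
    (hnb : ∀ i, 2 ≤ i → i + 2 ≤ k → ¬ G.Adj (p i) (c (d + a)))
    (hfar : ∀ i, 2 ≤ i → i + 2 ≤ k → ∀ y : ℕ, 1 ≤ y → y + d + 1 ≤ n →
      ¬ G.Adj (p i) (c (-y + a))) :
    ∃ q, Detour G (fun z => c (z + a)) n q k d ∧ ∀ l, 0 < l → l < k → q l = p l := by
  have h3 := h.three_le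
  have hR := h.ring
  have hst : Strand G (fun l => if l = 0 then c a else if l < k then p l else c (d + a)) k := by
    refine h.strand.replace_ends (by omega) ?_ ?_ (fun i h0 h1 => h.off i h0 h1 _)
      (fun i h0 h1 => h.off i h0 h1 _) ?_ ?_
    · intro he
      have := hR.inj _ _ (by omega) (by omega) he
      omega
    · rw [hR.adj _ _ (by omega) (by omega)]
      omega
    · intro i h0 h1
      rw [G.adj_comm]
      refine ⟨fun hA => ?_, fun hi => by rw [hi]; exact ha⟩
      by_contra hi1
      by_cases hik : i = k - 1
      · rw [hik] at hA
        rcases hb' _ hA with he | he | he <;>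
        · have := hR.inj _ _ (by omega) (by omega) he
          omega
      · exact hna i (by omega) (by omega) hA
    · intro i h0 h1
      rw [G.adj_comm]
      refine ⟨fun hA => ?_, fun hi => by rw [show i = k - 1 by omega]; exact hb⟩
      by_contra hik
      by_cases hi1 : i = 1
      · rw [hi1] at hA
        rcases ha' _ hA with he | he | he <;>
        · have := hR.inj _ _ (by omega) (by omega) he
          omega
      · exact hnb i (by omega) (by omega) hA
  have hq : ∀ l, 0 < l → l < k →
      (if l = 0 then c a else if l < k then p l else c (d + a)) = p l := by
    intro l h0 h1
    rw [if_neg (by omega), if_pos h1]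
  refine ⟨_, ⟨hR.shift a, hst, by simp, ?_, ?_, h3, hd, hd', ?_, ?_, ?_⟩, hq⟩
  · rw [if_neg (by omega), if_neg (by omega)]
  · intro l h0 h1 z
    rw [hq l h0 h1]
    exact h.off l h0 h1 _
  · intro j hj
    rw [hq 1 (by omega) (by omega)] at hj
    have := ha' _ hj
    rwa [zero_add, add_comm 1 a, add_comm 2 a]
  · intro j hj
    rw [hq (k - 1) (by omega) (by omega)] at hj
    have := hb' _ hj
    rwa [show (d : ℤ) - 1 + a = d + a - 1 by ring, show (d : ℤ) - 2 + a = d + a - 2 by ring]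
  · intro i hi hi' y hy hy'
    rw [hq i (by omega) (by omega)]
    exact hfar i hi hi' y hy hy'

theorem false_of_sparse (h : Shortcut G c n p k) (hG : Candidate G ℓ) (hℓ : 6 ≤ ℓ)
    (hℓe : Even ℓ) (hmin : NoShorter G ℓ n) {m : ℕ} (hm : n = 2 * m) (hlm : ℓ + 1 ≤ m)
    {d : ℤ} (hd : p k = c d) (hkd : k < d) (hdm : d ≤ m)
    (hmid : ∀ i, 2 ≤ i → i + 2 ≤ k → ∀ j : ℤ, ¬ G.Adj (p i) (c j)) : False := by
  have h3 := h.three_le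
  have hle := h.le
  obtain ⟨a, ha1, ha2, ha, ha'⟩ := h.clean.exists_hull h.ring
    (h.off 1 (by omega) (by omega)) h.adj_first
  obtain ⟨b, hb1, hb2, hb, hb'⟩ := h.clean.exists_hull_right h.ring
    (h.off (k - 1) (by omega) (by omega)) (h.adj_last hd)
  obtain ⟨d', hd'⟩ : ∃ d' : ℕ, b = d' + a := ⟨(b - a).toNat, by omega⟩
  subst hd'
  obtain ⟨q, hq, hqp⟩ := h.exists_detour (by omega) (by omega) ha hb ha' hb'
    (fun i hi hi' => hmid i hi hi' _) (fun i hi hi' => hmid i hi hi' _)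
    (fun i hi hi' y _ _ => hmid i hi hi' _)
  refine hq.false_of_sparse hG hℓ hℓe hmin hm hlm (by omega) (by omega) ?_ ?_
  · intro hlt
    rw [hqp 1 (by omega) (by omega), hqp (k - 1) (by omega) (by omega)]
    have : a = -2 ∨ d' + a = d + 2 := by omega
    rcases this with h1 | h1
    · left
      rw [h1]
      exact h.adj_first
    · right
      rw [show (d' : ℤ) - 2 + a = d by omega]
      exact h.adj_last hd
  · intro i hi hi' j
    rw [hqp i (by omega) (by omega)]
    exact hmid i hi hi' _

theorem false_of_contact (h : Shortcut G c n p k) (hG : Candidate G ℓ) (hℓ : 6 ≤ ℓ)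
    (hℓe : Even ℓ) (hmin : NoShorter G ℓ n) (hn : Even n) (hln : 2 * ℓ < n)
    {d : ℤ} (hd : p k = c d) (hkd : k < d) (hdk : d ≤ k + 2)
    {i : ℕ} (hi : 2 ≤ i) (hi' : i + 2 ≤ k) {τ : ℤ} (hτ : G.Adj (p i) (c τ))
    (hτ1 : τ ≤ i + 1) (hτ2 : d - τ ≤ k - i + 1) : False := by
  have h3 := h.three_le
  have hle := h.le
  have hR := h.ring
  obtain ⟨a, ha1, ha2, ha, ha'⟩ := h.clean.exists_hull h.ring
    (h.off 1 (by omega) (by omega)) h.adj_first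
  obtain ⟨b, hb1, hb2, hb, hb'⟩ := h.clean.exists_hull_right h.ring
    (h.off (k - 1) (by omega) (by omega)) (h.adj_last hd)
  obtain ⟨d', hd'⟩ : ∃ d' : ℕ, b = d' + a := ⟨(b - a).toNat, by omega⟩
  subst hd'
  have hτa : τ - a ≤ i + 1 := by
    obtain ⟨t, t1, t2, t3⟩ := h.near_left hi hi' ha hτ
    have := hR.inj _ _ (by omega) (by omega) t3
    omega
  have hτb : d' + a - τ ≤ k - i + 1 := by
    obtain ⟨t, t1, t2, t3⟩ := h.near_right hi hi' hb hτ
    have := hR.inj _ _ (by omega) (by omega) t3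
    omega
  have hdk' : d' ≤ k + 2 := by omega
  have hcon : ∀ l, 2 ≤ l → l + 2 ≤ k → ∀ z, G.Adj (p l) (c z) →
      ∃ s : ℤ, c z = c (s + a) ∧ ((l + d' - k - 1 ≤ s ∧ s ≤ l + 1) ∨
        (n = 2 * k + 4 ∧ d' = k + 2 ∧ s = -(l + 1))) := by
    intro l hl hl' z hz
    obtain ⟨s, s1, s2, s3⟩ := h.near_left hl hl' ha hz
    obtain ⟨t, t1, t2, t3⟩ := h.near_right hl hl' hb hz
    refine ⟨s, by rw [s3, add_comm], ?_⟩
    rw [hR.add_of_eq s3] at t3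
    by_cases hst : 0 ≤ s + t
    · have := hR.inj _ _ (by omega) (by omega) t3
      omega
    · rw [← hR.per (a + s + t)] at t3
      have := hR.inj _ _ (by omega) (by omega) t3
      omega
  have hcona : ∀ l, 2 ≤ l → l + 2 ≤ k → ¬ G.Adj (p l) (c a) := by
    intro l hl hl' hz
    obtain ⟨s, s1, s2⟩ := hcon l hl hl' _ hz
    have := hR.inj _ _ (by omega) (by omega) s1
    omega
  have hconb : ∀ l, 2 ≤ l → l + 2 ≤ k → ¬ G.Adj (p l) (c (d' + a)) := by
    intro l hl hl' hz
    obtain ⟨s, s1, s2⟩ := hcon l hl hl' _ hz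
    have := hR.inj _ _ (by omega) (by omega) s1
    omega
  by_cases hL : n = 2 * k + 4 ∧ d' = k + 2 ∧
      ∃ j, 2 ≤ j ∧ j + 2 ≤ k ∧ G.Adj (p j) (c (-(j + 1) + a))
  · obtain ⟨h1, h2, hL⟩ := hL
    have hcon' : ∀ l, 2 ≤ l → l + 2 ≤ k → ∀ z, G.Adj (p l) (c z) →
        c z = c (l + 1 + a) ∨ c z = c (-(l + 1) + a) := by
      intro l hl hl' z hz
      obtain ⟨s, s1, s2⟩ := hcon l hl hl' _ hz
      rcases s2 with s2 | ⟨-, -, s2⟩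
      · rw [s1, show s = l + 1 by omega]
        exact Or.inl rfl
      · rw [s1, s2]
        exact Or.inr rfl
    refine false_of_two_sided (hR.shift a) h.strand (fun l h0 h1 z => h.off l h0 h1 _) h1 hmin
      (by omega) hln (fun l hl hl' z hz => hcon' l hl hl' _ hz) ⟨i, hi, hi', ?_⟩ hL
    rwa [show (i : ℤ) + 1 + a = τ by omega]
  · have hcon' : ∀ l, 2 ≤ l → l + 2 ≤ k → ∀ z, G.Adj (p l) (c z) →
        ∃ s : ℤ, c z = c (s + a) ∧ l + d' - k - 1 ≤ s ∧ s ≤ l + 1 := by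
      intro l hl hl' z hz
      obtain ⟨s, s1, s2⟩ := hcon l hl hl' _ hz
      rcases s2 with s2 | ⟨s2, s3, s4⟩
      · exact ⟨s, s1, s2⟩
      · refine absurd ⟨s2, s3, l, hl, hl', ?_⟩ hL
        rwa [← s4, ← s1]
    obtain ⟨q, hq, hqp⟩ := h.exists_detour (by omega) (by omega) ha hb ha' hb' hcona hconb (by
      intro l hl hl' y hy hy' hz
      obtain ⟨s, s1, s2⟩ := hcon' l hl hl' _ hz
      have := hR.inj _ _ (by omega) (by omega) s1
      omega)
    have hodd := hq.odd hn hmin (by omega) (by omega)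
    rw [Nat.odd_iff] at hodd
    refine hq.false_of_ladder hG hℓ hℓe hmin (by omega) (by omega) (by omega) ?_
    intro l hl hl' j hj
    rw [hqp l (by omega) (by omega)] at hj
    obtain ⟨s, s1, s2⟩ := hcon' l hl hl' _ hj
    have : s = l ∨ s = l + 1 := by omega
    rcases this with rfl | rfl
    · exact Or.inl s1
    · exact Or.inr s1

theorem near_end (h : Shortcut G c n p k) (hG : Candidate G ℓ) (hℓ : 6 ≤ ℓ)
    (hℓe : Even ℓ) (hmin : NoShorter G ℓ n) (hn : Even n) (hln : 2 * ℓ < n)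
    {d : ℤ} (hd : p k = c d) : Near c 0 d k := by
  have h3 := h.three_le
  have hle := h.le
  have hR := h.ring
  by_contra hnear
  obtain ⟨d₀, hd0, hdn, he⟩ := hR.exists_window 0 d
  have hkd : k < d₀ := by
    by_contra hcon
    exact hnear ⟨d₀, by omega, by omega, by rw [zero_add, he]⟩
  have hkd' : d₀ < n - k := by
    by_contra hcon
    exact hnear ⟨d₀ - n, by omega, by omega, by
      rw [← he, ← hR.per (0 + (d₀ - n))]
      congr 1
      ring⟩
  rw [← he] at hd
  clear hnear he
  have hd_r : p k = (fun i => c (-i)) (n - d₀) := by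
    rw [hd]
    show c d₀ = c (-(n - d₀))
    rw [← hR.per (-(n - d₀))]
    congr 1
    ring
  by_cases hmid : ∀ i, 2 ≤ i → i + 2 ≤ k → ∀ j : ℤ, ¬ G.Adj (p i) (c j)
  · obtain ⟨m, hm⟩ := hn
    rcases le_or_gt d₀ m with hdm | hdm
    · exact h.false_of_sparse hG hℓ hℓe hmin (m := m) (by omega) (by omega) hd hkd hdm hmid
    · exact h.reflect.false_of_sparse hG hℓ hℓe hmin (m := m) (by omega) (by omega) hd_r
        (by omega) (by omega) (fun i hi hi' j => hmid i hi hi' _)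
  · push Not at hmid
    obtain ⟨i, hi, hi', z, hz⟩ := hmid
    obtain ⟨s, s1, s2, s3⟩ := h.near_left hi hi' h.adj_first hz
    obtain ⟨t, t1, t2, t3⟩ := h.near_right hi hi' (h.adj_last hd) hz
    rw [hR.add_of_eq s3] at t3
    rw [s3] at hz
    simp only [zero_add] at *
    by_cases hst : 0 ≤ s + t
    · have := hR.inj _ _ (by omega) (by omega) t3
      exact h.false_of_contact hG hℓ hℓe hmin hn hln hd hkd (by omega) hi hi' hz (by omega)
        (by omega)
    · rw [← hR.per (s + t)] at t3
      have := hR.inj _ _ (by omega) (by omega) t3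
      exact h.reflect.false_of_contact hG hℓ hℓe hmin hn hln hd_r (by omega) (by omega) hi hi'
        (τ := -s) (by rwa [neg_neg]) (by omega) (by omega)

end Shortcut

variable {c : ℤ → V} {n : ℕ}

theorem Reach.refl (x : V) : Reach G x x 0 :=
  ⟨Walk.nil, by simp⟩

theorem Reach.segment {x y : V} (W : G.Walk x y) (a b : ℕ) (hab : a ≤ b) (hb : b ≤ W.length) :
    Reach G (W.getVert a) (W.getVert b) (b - a) :=
  Reach.of_forall_adj (p := W.getVert) (fun _ hl => W.adj_getVert_succ hl) a b hab hb

theorem Strand.of_shortest {x y : V} {W : G.Walk x y} (h : ∀ r < W.length, ¬ Reach G x y r) :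
    Strand G W.getVert W.length := by
  have hskip : ∀ a b, a ≤ b → b ≤ W.length → ∀ r, r < b - a →
      ¬ Reach G (W.getVert a) (W.getVert b) r := by
    intro a b hab hb r hr hab'
    have h1 := ((Reach.segment W 0 a (by omega) (by omega)).trans hab').trans
      (Reach.segment W b _ hb le_rfl)
    rw [Walk.getVert_zero, Walk.getVert_length] at h1
    exact h _ (by omega) h1
  have hne : ∀ a b, a < b → b ≤ W.length → W.getVert a ≠ W.getVert b := by
    intro a b hab hb he
    refine hskip a b hab.le hb 0 (by omega) ?_
    rw [he]
    exact Reach.refl _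
  have hadj : ∀ a b, a < b → b ≤ W.length →
      (G.Adj (W.getVert a) (W.getVert b) ↔ b = a + 1) := by
    intro a b hab hb
    refine ⟨fun h => ?_, ?_⟩
    · by_contra hba
      exact hskip a b hab.le hb 1 (by omega) (Reach.of_adj h)
    · rintro rfl
      exact W.adj_getVert_succ (by omega)
  refine ⟨fun a b ha hb he => ?_, fun a b ha hb => ?_⟩
  · by_contra hab
    rcases lt_or_gt_of_ne hab with h | h
    · exact hne a b h hb he
    · exact hne b a h ha he.symm
  · rcases lt_trichotomy a b with h | h | h
    · rw [hadj a b h hb]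
      omega
    · subst h
      simp only [SimpleGraph.irrefl, false_iff]
      omega
    · rw [G.adj_comm, hadj b a h ha]
      omega

theorem CleanSeq.near_of_adj (hcl : CleanSeq G c) (hR : Ring G c n) {z : V} (hz : ∀ j, z ≠ c j)
    {i j : ℤ} (hi : G.Adj z (c i)) (hj : G.Adj z (c j)) : Near c i j 2 := by
  obtain ⟨e, he⟩ := hcl z hz
  have key : ∀ l, G.Adj z (c l) → ∃ x : ℤ, -1 ≤ x ∧ x ≤ 1 ∧ c l = c (e + x) := by
    intro l hl
    rcases he l hl with h | h | h
    · exact ⟨-1, by omega, by omega, h⟩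
    · exact ⟨0, by omega, by omega, by rwa [add_zero]⟩
    · exact ⟨1, by omega, by omega, h⟩
  obtain ⟨x, hx1, hx2, hx⟩ := key i hi
  obtain ⟨y, hy1, hy2, hy⟩ := key j hj
  refine ⟨y - x, by omega, by omega, ?_⟩
  rw [hy, hR.add_of_eq hx]
  congr 1
  ring

theorem Ring.near_of_adj (hR : Ring G c n) {i j : ℤ} (h : G.Adj (c i) (c j)) : Near c i j 1 := by
  obtain ⟨l, hl1, hl2, hl⟩ := hR.exists_window i j
  rw [← hl, hR.adj _ _ (by omega) (by omega)] at h
  have : l - i = 1 ∨ l - i = n - 1 := by omega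
  rcases this with h1 | h1
  · exact ⟨1, by omega, by omega, by rw [← hl]; congr 1; omega⟩
  · refine ⟨-1, by omega, by omega, ?_⟩
    rw [← hl, ← hR.per (i + -1)]
    congr 1
    omega

theorem near_of_reach (hR : Ring G c n) (hcl : CleanSeq G c) (hG : Candidate G ℓ) (hℓ : 6 ≤ ℓ)
    (hℓe : Even ℓ) (hmin : NoShorter G ℓ n) (hn : Even n) (hln : 2 * ℓ < n) (k : ℕ)
    (hk : 2 * k + 4 ≤ n) (i j : ℤ) (h : Reach G (c i) (c j) k) : Near c i j k := by
  induction k using Nat.strong_induction_on generalizing i j with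
  | _ k ih =>
    have hnear : ∀ i j : ℤ, ∀ r < k, Reach G (c i) (c j) r → Near c i j r :=
      fun i j r hr h => ih r hr (by omega) i j h
    by_contra hcon
    have hshort : ∀ r < k, ¬ Reach G (c i) (c j) r := fun r hr h =>
      hcon ((hnear i j r hr h).mono hr.le)
    obtain ⟨W, hW⟩ := h
    have hlen : W.length = k := by
      by_contra hne
      exact hshort W.length (by omega) ⟨W, le_rfl⟩
    subst hlen
    have hp0 : W.getVert 0 = c i := by simp
    have hpk : W.getVert W.length = c j := by simp
    have hstep : ∀ l < W.length, G.Adj (W.getVert l) (W.getVert (l + 1)) :=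
      fun l hl => W.adj_getVert_succ hl
    have hseg := Reach.segment W
    have hoff : ∀ l, 0 < l → l < W.length → ∀ z, W.getVert l ≠ c z := by
      intro l h0 h1 z hz
      have h2 := hseg 0 l (by omega) (by omega)
      have h3 := hseg l _ h1.le le_rfl
      rw [hp0, hz] at h2
      rw [hpk, hz] at h3
      have h4 := (hnear _ _ _ (by omega) h2).trans hR (hnear _ _ _ (by omega) h3)
      rw [show l - 0 + (W.length - l) = W.length by omega] at h4
      exact hcon h4
    have hst := Strand.of_shortest hshort
    rcases Nat.lt_or_ge W.length 3 with hlt | hge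
    · have : W.length = 0 ∨ W.length = 1 ∨ W.length = 2 := by omega
      rcases this with h0 | h1 | h2
      · rw [h0, hp0] at hpk
        exact hcon ⟨0, by omega, by omega, by rw [add_zero, hpk]⟩
      · have h := hstep 0 (by omega)
        rw [zero_add, hp0, ← h1, hpk] at h
        exact hcon (h1 ▸ hR.near_of_adj h)
      · have h := (hstep 0 (by omega)).symm
        have h' := hstep 1 (by omega)
        rw [zero_add, hp0] at h
        rw [show 1 + 1 = W.length by omega, hpk] at h'
        exact hcon (h2 ▸ hcl.near_of_adj hR (hoff 1 (by omega) (by omega)) h h')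
    · have hsc : Shortcut G (fun z => c (z + i)) n W.getVert W.length := by
        refine ⟨hR.shift i, hst, by simp, fun l h0 h1 z => hoff l h0 h1 _, hge, hk,
          hcl.shift i, fun x y r hr hxy => ?_⟩
        obtain ⟨t, t1, t2, t3⟩ := hnear _ _ r hr hxy
        refine ⟨t, t1, t2, ?_⟩
        beta_reduce
        rw [t3]
        congr 1
        ring
      obtain ⟨t, t1, t2, t3⟩ := hsc.near_end hG hℓ hℓe hmin hn hln (d := j - i)
        (by rw [hpk, sub_add_cancel])
      refine hcon ⟨t, t1, t2, ?_⟩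
      beta_reduce at t3
      rw [sub_add_cancel] at t3
      rw [t3]
      congr 1
      ring

theorem IsHole.cleanSeq {u : V} {w : G.Walk u u} (h : IsHole w) (hcl : ∀ z, ¬ CMajor G w z) :
    CleanSeq G (fun z => w.getVert (z % w.length).toNat) := by
  have hR := h.ring
  have hs := h.mem_support_iff
  intro z hz
  have hzs : z ∉ w.support := by
    rw [hs]
    rintro ⟨j, hj⟩
    exact hz j hj.symm
  have := hcl z
  rw [CMajor, not_and, not_not] at this
  obtain ⟨q, hq, hqz⟩ := this hzs
  obtain ⟨e, rfl⟩ := (hs q).1 hq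
  refine ⟨e, fun j hj => ?_⟩
  rcases hqz _ (w.getVert_mem_support _) hj with h1 | h1
  · exact Or.inr (Or.inl h1)
  · obtain ⟨t, t1, t2, t3⟩ := hR.near_of_adj (i := e) (j := j) (w.adj_of_mem_edges h1)
    have : t = -1 ∨ t = 0 ∨ t = 1 := by omega
    rcases this with rfl | rfl | rfl
    · exact Or.inl t3
    · rw [add_zero] at t3
      exact Or.inr (Or.inl t3)
    · exact Or.inr (Or.inr t3)

/-- A path following consecutive vertices of a cyclic sequence goes around it in one direction. -/
theorem Ring.exists_reflect {x y : V} (hR : Ring G c n) {W : G.Walk x y} (hW : W.IsPath)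
    (h0 : c 0 = x) (hWc : ∀ i < W.length, ∀ z, W.getVert i = c z →
      W.getVert (i + 1) = c (z + 1) ∨ W.getVert (i + 1) = c (z - 1)) :
    (∀ i ≤ W.length, W.getVert i = c i) ∨ (∀ i ≤ W.length, W.getVert i = c (-i)) := by
  have h4 := hR.four_le
  have hinj : ∀ i ≤ W.length, ∀ j ≤ W.length, W.getVert i = W.getVert j → i = j :=
    fun i hi j hj he => hW.getVert_injOn hi hj he
  have h00 : W.getVert 0 = c 0 := by simp [h0]
  have main : ∀ c : ℤ → V, Ring G c n → W.getVert 0 = c 0 → W.getVert 1 = c 1 →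
      (∀ i < W.length, ∀ z, W.getVert i = c z →
        W.getVert (i + 1) = c (z + 1) ∨ W.getVert (i + 1) = c (z - 1)) →
      ∀ i ≤ W.length, W.getVert i = c i := by
    intro c hR h0 h1 hWc i
    induction i using Nat.strong_induction_on with
    | _ i ih =>
      intro hi
      match i with
      | 0 => simpa using h0
      | 1 => simpa using h1
      | i + 2 =>
        have e1 := ih (i + 1) (by omega) (by omega)
        have e0 := ih i (by omega) (by omega)
        rcases hWc (i + 1) (by omega) _ e1 with h | h
        · rw [h]
          congr 1
        · rw [show ((i + 1 : ℕ) : ℤ) - 1 = i by push_cast; ring, ← e0] at h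
          have := hinj _ (by omega) _ (by omega) h
          omega
  rcases Nat.eq_zero_or_pos W.length with hl | hl
  · left
    intro i hi
    rw [show i = 0 by omega]
    simpa using h00
  · rcases hWc 0 hl 0 h00 with h | h
    · exact Or.inl (main c hR h00 (by simpa using h) hWc)
    · right
      refine main (fun i => c (-i)) hR.reflect (by simpa using h00) (by simpa using h) ?_
      intro i hi z hz
      have := hWc i hi _ hz
      rw [show -(z + 1) = -z - 1 by ring, show -(z - 1) = -z + 1 by ring]
      tauto

theorem isHole_reroute {x y : V} {a : ℕ} (hR : Ring G c n) (h0 : c 0 = x) (hy : c a = y)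
    (ha : 2 ≤ a) (han : 2 * a + 4 ≤ n)
    (hnear : ∀ k, 2 * k + 4 ≤ n → ∀ i j : ℤ, Reach G (c i) (c j) k → Near c i j k)
    {P L : G.Walk x y} (hP : ∀ Q : G.Walk x y, P.length ≤ Q.length) (hPa : P.length ≤ a)
    (hLn : L.length + a = n) (hL : ∀ i ≤ L.length, L.getVert i = c (-i)) :
    IsHole (P.append L.reverse) ∧ (P.append L.reverse).length = n := by
  have hst : Strand G P.getVert P.length := by
    refine Strand.of_shortest ?_
    rintro r hr ⟨Q, hQ⟩
    have := hP Q
    omega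
  have hPa' : P.length = a := by
    obtain ⟨t, t1, t2, t3⟩ := hnear P.length (by omega) 0 a (by rw [h0, hy]; exact ⟨P, le_rfl⟩)
    have := hR.inj _ _ (by omega) (by omega) t3
    omega
  have hp0 : P.getVert 0 = c 0 := by rw [h0, Walk.getVert_zero]
  have hpa : P.getVert a = c a := by rw [hy, ← hPa', Walk.getVert_length]
  have hhead : ∀ i ≤ a, Reach G (c 0) (P.getVert i) i := by
    intro i hi
    have := Reach.segment P 0 i (by omega) (by omega)
    rwa [hp0] at this
  have htail : ∀ i ≤ a, Reach G (P.getVert i) (c a) (a - i) := by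
    intro i hi
    have := Reach.segment P i a hi (by omega)
    rwa [hpa] at this
  have hmem : ∀ i, i ≤ a → ∀ t, P.getVert i = c t → c t = c i := by
    intro i hi t ht
    have e1 := hhead i hi
    have e2 := htail i hi
    rw [ht] at e1 e2
    obtain ⟨s, s1, s2, s3⟩ := hnear _ (by omega) _ _ e1
    obtain ⟨r, r1, r2, r3⟩ := hnear _ (by omega) _ _ e2
    rw [hR.add_of_eq s3] at r3
    have := hR.inj _ _ (by omega) (by omega) r3
    rw [s3]
    congr 1
    omega
  have hadj : ∀ i, 0 < i → i < a → ∀ t, G.Adj (P.getVert i) (c t) →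
      ∃ s : ℤ, i - 1 ≤ s ∧ s ≤ i + 1 ∧ c t = c s := by
    intro i hi0 hi t ht
    obtain ⟨s, s1, s2, s3⟩ := hnear _ (by omega) _ _ ((hhead i hi.le).trans (Reach.of_adj ht))
    obtain ⟨r, r1, r2, r3⟩ := hnear _ (by omega) _ _
      ((Reach.of_adj ht.symm).trans (htail i hi.le))
    rw [hR.add_of_eq s3] at r3
    have := hR.inj _ _ (by omega) (by omega) r3
    exact ⟨s, by omega, by omega, by rw [s3, zero_add]⟩
  have hlen : (P.append L.reverse).length = n := by
    rw [Walk.length_append, Walk.length_reverse]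
    omega
  have hlow : ∀ i < a, (P.append L.reverse).getVert i = P.getVert i := by
    intro i hi
    rw [Walk.getVert_append, if_pos (by omega)]
  have hhigh : ∀ i, a ≤ i → i < n → (P.append L.reverse).getVert i = c i := by
    intro i hi hin
    rw [Walk.getVert_append, if_neg (by omega), Walk.getVert_reverse, hL _ (by omega),
      ← hR.per (-_)]
    congr 1
    omega
  refine ⟨isHole_of_holeFun _ ⟨by omega, fun i j hij hj => ?_, fun i j hij hj => ?_⟩, hlen⟩
  · rw [hlen] at hj
    rcases Nat.lt_or_ge i a with hi | hi
    · rw [hlow i hi]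
      rcases Nat.lt_or_ge j a with hja | hja
      · rw [hlow j hja]
        intro he
        have := hst.inj _ _ (by omega) (by omega) he
        omega
      · rw [hhigh j hja hj]
        intro he
        have := hR.inj _ _ (by omega) (by omega) (hmem i hi.le _ he)
        omega
    · rw [hhigh i hi (by omega), hhigh j (by omega) hj]
      intro he
      have := hR.inj _ _ (by omega) (by omega) he
      omega
  · rw [hlen] at hj ⊢
    rcases Nat.lt_or_ge i a with hi | hi
    · rw [hlow i hi]
      rcases Nat.lt_or_ge j a with hja | hja
      · rw [hlow j hja, hst.adj _ _ (by omega) (by omega)]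
        omega
      · rw [hhigh j hja hj]
        rcases Nat.eq_zero_or_pos i with rfl | hi0
        · rw [hp0, hR.adj _ _ (by omega) (by omega)]
          omega
        · constructor
          · intro hA
            obtain ⟨s, s1, s2, s3⟩ := hadj i hi0 hi _ hA
            have := hR.inj _ _ (by omega) (by omega) s3
            omega
          · intro hA
            have hja' : j = a := by omega
            rw [hja', ← hpa, hst.adj _ _ (by omega) (by omega)]
            omega
    · rw [hhigh i hi (by omega), hhigh j (by omega) hj, hR.adj _ _ (by omega) (by omega)]
      omega

theorem Ring.length_add_length {x y : V} (hR : Ring G c n) {L L' : G.Walk x y} (hxy : x ≠ y)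
    (h : ∀ i ≤ L.length, L.getVert i = c i) (h' : ∀ i ≤ L'.length, L'.getVert i = c (-i))
    (hL : L.IsPath) (hL' : L'.IsPath) : L.length + L'.length = n := by
  have h4 := hR.four_le
  have hl : 0 < L.length := Nat.pos_of_ne_zero fun h => hxy (Walk.eq_of_length_eq_zero h)
  have hlt : L.length < n := by
    by_contra hcon
    have e : L.getVert n = L.getVert 0 := by
      rw [h n (by omega), h 0 (by omega), ← hR.per ((0 : ℕ) : ℤ)]
      congr 1
      simp
    have := hL.getVert_injOn (show n ≤ L.length by omega) (show 0 ≤ L.length by omega) e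
    omega
  have hlt' : L'.length < n := by
    by_contra hcon
    have e : L'.getVert n = L'.getVert 0 := by
      rw [h' n (by omega), h' 0 (by omega), ← hR.per (-(n : ℤ))]
      congr 1
      simp
    have := hL'.getVert_injOn (show n ≤ L'.length by omega) (show 0 ≤ L'.length by omega) e
    omega
  have e : c L.length = c (-L'.length + n) := by
    rw [hR.per, ← h _ le_rfl, ← h' _ le_rfl, Walk.getVert_length, Walk.getVert_length]
  have := hR.inj _ _ (by omega) (by omega) e
  omega

theorem Ring.getVert_succ {u x y : V} {w : G.Walk u u} (hR : Ring G c n)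
    (hs : ∀ v, v ∈ w.support ↔ ∃ z, c z = v) {L : G.Walk x y} (hL : ∀ e ∈ L.edges, e ∈ w.edges)
    (i : ℕ) (hi : i < L.length) (z : ℤ) (hz : L.getVert i = c z) :
    L.getVert (i + 1) = c (z + 1) ∨ L.getVert (i + 1) = c (z - 1) := by
  have he : s(L.getVert i, L.getVert (i + 1)) ∈ L.edges :=
    (Walk.mk_mem_edges_iff_exists _).2 ⟨i, hi, rfl⟩
  obtain ⟨z', hz'⟩ := (hs _).1 (w.snd_mem_support_of_mem_edges (hL _ he))
  have hA := L.adj_getVert_succ hi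
  rw [hz, ← hz'] at hA
  obtain ⟨t, t1, t2, t3⟩ := hR.near_of_adj hA
  have : t = -1 ∨ t = 0 ∨ t = 1 := by omega
  rw [← hz', t3]
  rcases this with rfl | rfl | rfl
  · exact Or.inr rfl
  · rw [t3, add_zero] at hA
    exact absurd rfl hA.ne
  · exact Or.inl rfl

end LEH

/-- rerouting a clean shortest long even hole along a shortest path yields
a shortest long even hole. -/
theorem easyreroute {V : Type*} [Fintype V]
    (ℓ : ℕ) (hℓ : 6 ≤ ℓ) (hℓeven : Even ℓ)
    (G : SimpleGraph V) (hG : Candidate G ℓ)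
    {u : V} (c : G.Walk u u) (hc : ShortestLEH G ℓ c)
    (hclean : ∀ z, ¬ CMajor G c z)
    (x y : V) (hx : x ∈ c.support) (hy : y ∈ c.support)
    (hxy : x ≠ y) (hadj : ¬ G.Adj x y)
    (L₁ L₂ : G.Walk x y) (hL : ArcPair c L₁ L₂)
    (hdist : holeDist G c x y ≤ c.length / 2 - 2)
    (hL₁ : L₁.length ≤ c.length / 2 - 2) :
    ∀ P : G.Walk x y, P.IsPath → (∀ Q : G.Walk x y, P.length ≤ Q.length) →
      ShortestLEH G ℓ (P.append L₂.reverse) := by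
  have hhole := hc.1.1
  have hmin : NoShorter G ℓ c.length := fun v c' h => hc.2 v c' h
  have hln : 2 * ℓ < c.length := by
    by_contra hcon
    exact hG.1.1 ⟨u, c, hc.1, by omega⟩
  obtain ⟨d₀, hR₀, hcl, hs⟩ : ∃ d₀ : ℤ → V, LEH.Ring G d₀ c.length ∧ CleanSeq G d₀ ∧
      ∀ v, v ∈ c.support ↔ ∃ z, d₀ z = v :=
    ⟨_, hhole.ring, hhole.cleanSeq hclean, hhole.mem_support_iff⟩
  obtain ⟨e, he⟩ := (hs x).1 hx
  obtain ⟨d, hR, hd0, hcl, hs, hd₁⟩ : ∃ d : ℤ → V, LEH.Ring G d c.length ∧ d 0 = x ∧ CleanSeq G d ∧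
      (∀ v, v ∈ c.support ↔ ∃ z, d z = v) ∧ ∀ i ≤ L₁.length, L₁.getVert i = d i := by
    have hR := hR₀.shift e
    have hs' : ∀ v, v ∈ c.support ↔ ∃ z, d₀ (z + e) = v := by
      intro v
      rw [hs]
      exact ⟨fun ⟨z, hz⟩ => ⟨z - e, by rwa [sub_add_cancel]⟩, fun ⟨z, hz⟩ => ⟨_, hz⟩⟩
    rcases hR.exists_reflect hL.1 (by simpa using he) (hR.getVert_succ hs' hL.2.2.1)
      with h | h
    · exact ⟨_, hR, by simpa using he, hcl.shift e, hs', h⟩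
    · refine ⟨_, hR.reflect, by simpa using he, (hcl.shift e).reflect, fun v => ?_, h⟩
      rw [hs']
      exact ⟨fun ⟨z, hz⟩ => ⟨-z, by simpa using hz⟩, fun ⟨z, hz⟩ => ⟨-z, hz⟩⟩
  have hpos : ∀ W : G.Walk x y, 2 ≤ W.length := by
    intro W
    by_contra hcon
    have : W.length = 0 ∨ W.length = 1 := by omega
    rcases this with h | h
    · exact hxy (Walk.eq_of_length_eq_zero h)
    · exact hadj (Walk.adj_of_length_eq_one h)
  have hd₂ : ∀ i ≤ L₂.length, L₂.getVert i = d (-i) := by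
    rcases hR.exists_reflect hL.2.1 hd0 (hR.getVert_succ hs hL.2.2.2.1) with h | h
    · have h₁ := hpos L₁
      have h₂ := hpos L₂
      refine absurd ?_ (hL.2.2.2.2.2 s(d 0, d 1) ?_)
      · rw [Walk.mk_mem_edges_iff_exists]
        exact ⟨0, by omega, by rw [h 0 (by omega), h (0 + 1) (by omega)]; simp⟩
      · rw [Walk.mk_mem_edges_iff_exists]
        exact ⟨0, by omega, by rw [hd₁ 0 (by omega), hd₁ (0 + 1) (by omega)]; simp⟩
    · exact h
  have hlen := hR.length_add_length hxy hd₁ hd₂ hL.1 hL.2.1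
  have hL2 := hpos L₁
  intro P _ hPmin
  obtain ⟨h₁, h₂⟩ := isHole_reroute hR hd0 (by rw [← hd₁ _ le_rfl, Walk.getVert_length]) hL2
    (by omega) (near_of_reach hR hcl hG hℓ hℓeven hmin hc.1.2.2 hln) hPmin (hPmin L₁) (by omega)
    hd₂
  refine ⟨⟨h₁, ?_, ?_⟩, fun v c' h => ?_⟩
  · rw [h₂]
    exact hc.1.2.1
  · rw [h₂]
    exact hc.1.2.2
  · rw [h₂]
    exact hc.2 v c' h
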